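/- arXiv:0906.5402 — 2 statements merged into one kernel-verified Lean document; each statement's English description precedes it below -/
import Mathlib

section
/- (Theorem 1, case p = 1.) Let f ∈ H^∞ have a boundary function f* with Λ(f) < ∞ (i.e. f ∈ 𝔑). Then the Toeplitz operator T_f is bounded on H^1: for every h ∈ H^1 with boundary function h* ∈ L^1(𝕋), the function T_f h is analytic on 𝔻 and ‖T_f h‖_{H^1} ≤ (‖f‖_{H^∞} + Λ(f)) · ‖h‖_{H^1}. -/
open MeasureTheory Complex Metric Set
open scoped ENNReal

/-- Normalized Lebesgue (arc-length) measure on the unit circle `𝕋 ⊆ ℂ`. -/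
noncomputable def circleMeasure : Measure ℂ :=
  Measure.map (fun θ : ℝ => Complex.exp (θ * Complex.I))
    ((ENNReal.ofReal (2 * Real.pi))⁻¹ • volume.restrict (Set.Ioc 0 (2 * Real.pi)))

/-- `‖f‖_{H^p}^p = sup_{0<r<1} ∫_𝕋 |f(rζ)|^p dm(ζ)`, as a value in `[0,∞]`. -/
noncomputable def hardyNorm (p : ℝ) (f : ℂ → ℂ) : ℝ≥0∞ :=
  ⨆ r ∈ Set.Ioo (0 : ℝ) 1,
    ∫⁻ ζ, ENNReal.ofReal (‖f (↑r * ζ)‖ ^ p) ∂circleMeasure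

/-- `‖f‖_{H^∞} = sup_{z ∈ 𝔻} |f(z)|`, as a value in `[0,∞]`. -/
noncomputable def eSupAbs (f : ℂ → ℂ) : ℝ≥0∞ :=
  ⨆ z ∈ Metric.ball (0 : ℂ) 1, ENNReal.ofReal ‖f z‖

/-- `g` is the boundary function of `f` : radial limits a.e. on `𝕋`. -/
def IsBoundaryFn (f g : ℂ → ℂ) : Prop :=
  ∀ᵐ ζ ∂circleMeasure,
    Filter.Tendsto (fun r : ℝ => f (↑r * ζ)) (nhdsWithin 1 (Set.Iio 1)) (nhds (g ζ))

/-- `Λ(f) = ess sup_{η ∈ 𝕋} ∫_𝕋 |f*(ζ) - f*(η)|/|ζ - η| dm(ζ)` for a boundary function `f*`. -/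
noncomputable def Lam (g : ℂ → ℂ) : ℝ≥0∞ :=
  essSup (fun η =>
    ∫⁻ ζ, ENNReal.ofReal (‖g ζ - g η‖ / ‖ζ - η‖) ∂circleMeasure)
    circleMeasure

/-- Toeplitz operator: `(T_g h)(z) = ∫_𝕋 conj(g*(ζ)) h*(ζ)/(1 - conj(ζ) z) dm(ζ)`,
given boundary functions `gs = g*`, `hs = h*`. -/
noncomputable def toeplitz (gs hs : ℂ → ℂ) : ℂ → ℂ := fun z =>
  ∫ ζ, (starRingEnd ℂ) (gs ζ) * hs ζ / (1 - (starRingEnd ℂ) ζ * z) ∂circleMeasure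

/-- `f̂(n)`, the `n`-th Taylor coefficient of `f` at `0`. -/
noncomputable def taylorCoeff (f : ℂ → ℂ) (n : ℕ) : ℂ :=
  iteratedDeriv n f 0 / n.factorial

/-- `(f*α)(z) = ∑_{n≥0} f̂(n) α_n z^n`. -/
noncomputable def seqConv (f : ℂ → ℂ) (α : ℕ → ℝ) : ℂ → ℂ := fun z =>
  ∑' n : ℕ, taylorCoeff f n * (α n : ℂ) * z ^ n

/-- Partial sum `S_n(f)(z) = ∑_{k=0}^n f̂(k) z^k`. -/
noncomputable def taylorPartial (f : ℂ → ℂ) (n : ℕ) (z : ℂ) : ℂ :=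
  ∑ k ∈ Finset.range (n + 1), taylorCoeff f k * z ^ k

/-- Cesàro mean `σ_n(f)(z) = (1/(n+1)) ∑_{k=0}^n S_k(f)(z)`. -/
noncomputable def cesaro (f : ℂ → ℂ) (n : ℕ) (z : ℂ) : ℂ :=
  ((n : ℂ) + 1)⁻¹ * ∑ k ∈ Finset.range (n + 1), taylorPartial f k z



lemma cm_measurable : Measurable (fun θ : ℝ => Complex.exp (θ * Complex.I)) := by
  fun_prop

instance cm_prob : IsProbabilityMeasure circleMeasure := by
  unfold circleMeasure
  constructor
  rw [Measure.map_apply cm_measurable MeasurableSet.univ]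
  simp only [preimage_univ, Measure.smul_apply, Measure.restrict_apply_univ, Real.volume_Ioc,
    sub_zero, smul_eq_mul]
  rw [ENNReal.inv_mul_cancel]
  · simp [Real.pi_pos]
  · exact ENNReal.ofReal_ne_top

lemma cm_ae : ∀ᵐ ζ ∂circleMeasure, ζ ∈ sphere (0 : ℂ) 1 := by
  unfold circleMeasure
  refine (ae_map_iff (p := fun ζ => ζ ∈ sphere (0 : ℂ) 1) cm_measurable.aemeasurable
    (isClosed_sphere (x := (0 : ℂ)) (ε := 1)).measurableSet).2 ?_
  refine Filter.Eventually.of_forall fun θ => ?_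
  simp [Complex.norm_exp_ofReal_mul_I]

lemma cm_restrict : circleMeasure.restrict (sphere (0 : ℂ) 1) = circleMeasure :=
  Measure.restrict_eq_self_of_ae_mem cm_ae

lemma cm_integrable {E : Type*} [NormedAddCommGroup E] {g : ℂ → E}
    (hg : ContinuousOn g (sphere (0 : ℂ) 1)) : Integrable g circleMeasure := by
  rw [← cm_restrict]
  exact hg.integrableOn_compact (isCompact_sphere _ _)

lemma cm_integral {E : Type*} [NormedAddCommGroup E] [NormedSpace ℝ E] {g : ℂ → E}
    (hg : ContinuousOn g (sphere (0 : ℂ) 1)) :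
    ∫ ζ, g ζ ∂circleMeasure = Real.circleAverage g 0 1 := by
  have h1 := (cm_integrable hg).aestronglyMeasurable
  unfold circleMeasure at h1 ⊢
  rw [integral_map cm_measurable.aemeasurable h1, integral_smul_measure, Real.circleAverage_def,
    intervalIntegral.integral_of_le Real.two_pi_pos.le]
  simp [circleMap, Real.pi_pos.le]

lemma cm_cauchy {g : ℂ → ℂ} (hg : DiffContOnCl ℂ g (ball (0 : ℂ) 1)) {w : ℂ}
    (hw : w ∈ ball (0 : ℂ) 1) :
    ∫ ζ, g ζ / (1 - (starRingEnd ℂ) ζ * w) ∂circleMeasure = g w := by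
  have h0 : ContinuousOn g (closedBall 0 1) := by
    have := hg.continuousOn
    rwa [closure_ball _ one_ne_zero] at this
  have hne : ∀ ζ ∈ sphere (0 : ℂ) 1, 1 - (starRingEnd ℂ) ζ * w ≠ 0 := by
    intro ζ hζ h
    rw [sub_eq_zero] at h
    have := congrArg norm h
    simp at this hζ hw
    rw [hζ] at this
    linarith
  rw [cm_integral]
  · have := hg
    have h2 := DiffContOnCl.circleAverage_smul_div (c := 0) (R := 1) (f := g) (w := w)
      (by simpa using hg) (by simpa using hw)
    rw [← h2]
    apply Real.circleAverage_congr_sphere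
    intro ζ hζ
    have hζ1 : ζ ∈ sphere (0 : ℂ) 1 := by simpa using hζ
    have h3 := hne ζ hζ1
    have hζn : ‖ζ‖ = 1 := by simpa using hζ1
    have h4 : ζ * (starRingEnd ℂ) ζ = 1 := by
      rw [Complex.mul_conj, Complex.normSq_eq_norm_sq, hζn]; simp
    have h5 : ζ - w = ζ * (1 - (starRingEnd ℂ) ζ * w) := by
      linear_combination  w * h4
    have h6 : ζ ≠ 0 := by rintro rfl; simp at hζn
    simp only [sub_zero, smul_eq_mul]
    rw [h5]
    field_simp
  · refine ContinuousOn.div (h0.mono sphere_subset_closedBall) ?_ hne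
    fun_prop

lemma cm_orth (n m : ℕ) :
    ∫ ζ, ζ ^ n * (starRingEnd ℂ) (ζ ^ m) ∂circleMeasure = if n = m then 1 else 0 := by
  have key : ∀ k : ℕ, k ≠ 0 → ∫ ζ, ζ ^ k ∂circleMeasure = 0 := by
    intro k hk
    have := cm_cauchy (g := fun z => z ^ k) (w := 0)
      (Differentiable.diffContOnCl (by fun_prop)) (by simp)
    simpa [hk] using this
  have hz : ∀ᵐ ζ ∂circleMeasure, ζ * (starRingEnd ℂ) ζ = 1 := by
    filter_upwards [cm_ae] with ζ hζ
    have hζn : ‖ζ‖ = 1 := by simpa using hζ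
    rw [Complex.mul_conj, Complex.normSq_eq_norm_sq, hζn]; simp
  rcases lt_trichotomy n m with hnm | hnm | hnm
  · obtain ⟨k, rfl⟩ := Nat.exists_eq_add_of_lt hnm
    have : ∫ ζ, ζ ^ n * (starRingEnd ℂ) (ζ ^ (n + k + 1)) ∂circleMeasure
        = ∫ ζ, (starRingEnd ℂ) (ζ ^ (k + 1)) ∂circleMeasure := by
      apply integral_congr_ae
      filter_upwards [hz] with ζ hζ
      have : (ζ * (starRingEnd ℂ) ζ) ^ n = 1 := by rw [hζ, one_pow]
      rw [mul_pow] at this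
      simp only [map_pow]
      rw [show n + k + 1 = n + (k + 1) by ring, pow_add, ← mul_assoc, this, one_mul]
    rw [this, integral_conj, key _ (by omega), if_neg (by omega)]
    simp
  · subst hnm
    rw [if_pos rfl]
    have : ∫ ζ, ζ ^ n * (starRingEnd ℂ) (ζ ^ n) ∂circleMeasure
        = ∫ ζ, (1 : ℂ) ∂circleMeasure := by
      apply integral_congr_ae
      filter_upwards [hz] with ζ hζ
      rw [map_pow, ← mul_pow, hζ, one_pow]
    rw [this]; simp
  · obtain ⟨k, rfl⟩ := Nat.exists_eq_add_of_lt hnm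
    have : ∫ ζ, ζ ^ (m + k + 1) * (starRingEnd ℂ) (ζ ^ m) ∂circleMeasure
        = ∫ ζ, ζ ^ (k + 1) ∂circleMeasure := by
      apply integral_congr_ae
      filter_upwards [hz] with ζ hζ
      have : (ζ * (starRingEnd ℂ) ζ) ^ m = 1 := by rw [hζ, one_pow]
      rw [mul_pow] at this
      simp only [map_pow]
      rw [show m + k + 1 = m + (k + 1) by ring, pow_add]
      linear_combination ζ ^ (k + 1) * this
    rw [this, key _ (by omega), if_neg (by omega)]

lemma cm_parseval_fin (c : ℕ → ℂ) (N : ℕ) :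
    ∫ ζ, ‖∑ n ∈ Finset.range N, c n * ζ ^ n‖ ^ 2 ∂circleMeasure
      = ∑ n ∈ Finset.range N, ‖c n‖ ^ 2 := by
  have h1 : ∀ ζ : ℂ, ((‖∑ n ∈ Finset.range N, c n * ζ ^ n‖ ^ 2 : ℝ) : ℂ)
      = ∑ n ∈ Finset.range N, ∑ m ∈ Finset.range N,
        (c n * (starRingEnd ℂ) (c m)) * (ζ ^ n * (starRingEnd ℂ) (ζ ^ m)) := by
    intro ζ
    rw [← Complex.normSq_eq_norm_sq, ← Complex.mul_conj, map_sum, Finset.sum_mul_sum]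
    refine Finset.sum_congr rfl fun n _ => Finset.sum_congr rfl fun m _ => ?_
    rw [map_mul]; ring
  have h2 : ((∫ ζ, ‖∑ n ∈ Finset.range N, c n * ζ ^ n‖ ^ 2 ∂circleMeasure : ℝ) : ℂ)
      = ((∑ n ∈ Finset.range N, ‖c n‖ ^ 2 : ℝ) : ℂ) := by
    rw [← integral_complex_ofReal]
    simp_rw [h1]
    rw [integral_finsetSum]
    · push_cast
      refine Finset.sum_congr rfl fun n hn => ?_
      rw [integral_finsetSum]
      · simp_rw [integral_const_mul, cm_orth]
        simp only [mul_ite, mul_one, mul_zero]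
        rw [Finset.sum_ite_eq, if_pos hn, Complex.mul_conj, Complex.normSq_eq_norm_sq]
        push_cast; rfl
      · intro m _
        exact cm_integrable (by fun_prop)
    · intro n _
      exact cm_integrable (by fun_prop)
  exact_mod_cast h2
  
lemma cm_parseval {c : ℕ → ℂ} (hc : Summable fun n => ‖c n‖) {g : ℂ → ℂ}
    (hg : ∀ ζ ∈ sphere (0 : ℂ) 1, HasSum (fun n => c n * ζ ^ n) (g ζ)) :
    HasSum (fun n => ‖c n‖ ^ 2) (∫ ζ, ‖g ζ‖ ^ 2 ∂circleMeasure) := by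
  rw [hasSum_iff_tendsto_nat_of_nonneg (fun n => by positivity)]
  simp_rw [← cm_parseval_fin]
  refine tendsto_integral_of_dominated_convergence (fun _ => (∑' n, ‖c n‖) ^ 2) ?_ ?_ ?_ ?_
  · intro n
    exact (cm_integrable (by fun_prop)).aestronglyMeasurable
  · exact integrable_const _
  · intro N
    filter_upwards [cm_ae] with ζ hζ
    have hζn : ‖ζ‖ = 1 := by simpa using hζ
    rw [Real.norm_of_nonneg (by positivity)]
    gcongr
    refine (norm_sum_le _ _).trans ?_
    simp only [norm_mul, norm_pow, hζn, one_pow, mul_one]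
    exact hc.sum_le_tsum _ (fun _ _ => norm_nonneg _)
  · filter_upwards [cm_ae] with ζ hζ
    exact ((hg ζ hζ).tendsto_sum_nat.norm).pow 2


/-- Riesz-type factorization of a function on the closed disc. -/
def Fac (p : ℂ → ℂ) : Prop :=
  ∃ a b : ℂ → ℂ, ContinuousOn a (closedBall 0 1) ∧ ContinuousOn b (closedBall 0 1) ∧
    DifferentiableOn ℂ a (ball 0 1) ∧ DifferentiableOn ℂ b (ball 0 1) ∧
    (∀ z ∈ closedBall (0 : ℂ) 1, p z = a z * b z) ∧
    ∀ z ∈ sphere (0 : ℂ) 1, ‖a z‖ = ‖b z‖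

lemma Fac.mul {p q : ℂ → ℂ} (hp : Fac p) (hq : Fac q) : Fac (fun z => p z * q z) := by
  obtain ⟨a, b, h1, h2, h3, h4, h5, h6⟩ := hp
  obtain ⟨c, d, g1, g2, g3, g4, g5, g6⟩ := hq
  refine ⟨fun z => a z * c z, fun z => b z * d z, h1.mul g1, h2.mul g2, h3.mul g3, h4.mul g4,
    ?_, ?_⟩
  · intro z hz
    simp only [h5 z hz, g5 z hz]; ring
  · intro z hz
    simp only [norm_mul, h6 z hz, g6 z hz]

lemma sqrt_mul_self' (x : ℂ) : x ^ (2⁻¹ : ℂ) * x ^ (2⁻¹ : ℂ) = x := by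
  have := Complex.cpow_nat_inv_pow x (n := 2) (by norm_num)
  rw [pow_two] at this
  exact_mod_cast this

lemma Fac.const (c : ℂ) : Fac (fun _ => c) :=
  ⟨fun _ => c ^ (2⁻¹ : ℂ), fun _ => c ^ (2⁻¹ : ℂ), by fun_prop, by fun_prop, by fun_prop,
    by fun_prop, fun _ _ => (sqrt_mul_self' c).symm, fun _ _ => rfl⟩

lemma sq_cont {u : ℂ} (hu : ‖u‖ ≤ 1) :
    ContinuousOn (fun z => (1 - u * z) ^ (2⁻¹ : ℂ)) (closedBall (0 : ℂ) 1) := by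
  intro z hz
  apply ContinuousAt.continuousWithinAt
  have : 0 ≤ (1 - u * z).re := by
    have h1 : (u * z).re ≤ ‖u * z‖ := Complex.re_le_norm _
    have h2 : ‖u * z‖ ≤ 1 := by
      rw [norm_mul]
      exact mul_le_one₀ hu (norm_nonneg _) (by simpa using hz)
    simp only [sub_re, one_re]; linarith
  exact ContinuousAt.comp (f := fun z => 1 - u * z) (g := fun w => w ^ (2⁻¹ : ℂ))
    (Complex.continuousAt_cpow_const_of_re_pos (Or.inl this) (by norm_num)) (by fun_prop)

lemma sq_diff {u : ℂ} (hu : ‖u‖ ≤ 1) :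
    DifferentiableOn ℂ (fun z => (1 - u * z) ^ (2⁻¹ : ℂ)) (ball (0 : ℂ) 1) := by
  apply DifferentiableOn.cpow_const (by fun_prop)
  intro z hz
  left
  have h1 : (u * z).re ≤ ‖u * z‖ := Complex.re_le_norm _
  have h2 : ‖u * z‖ < 1 := by
    rw [norm_mul]
    have : ‖z‖ < 1 := by simpa using hz
    nlinarith [norm_nonneg u, norm_nonneg z]
  simp only [sub_re, one_re]; linarith

lemma Fac.of_one_sub {u : ℂ} (hu : ‖u‖ ≤ 1) : Fac (fun z => 1 - u * z) :=
  ⟨_, _, sq_cont hu, sq_cont hu, sq_diff hu, sq_diff hu,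
    fun _ _ => (sqrt_mul_self' _).symm, fun _ _ => rfl⟩

lemma Fac.linear (w : ℂ) : Fac (fun z => z - w) := by
  by_cases hw : 1 ≤ ‖w‖
  · have h0 : w ≠ 0 := by rintro rfl; simp at hw; linarith
    have := (Fac.const (-w)).mul (Fac.of_one_sub (u := w⁻¹) (by
      rw [norm_inv]; exact inv_le_one_of_one_le₀ hw))
    convert! this using 2
    field_simp; ring
  · push Not at hw
    set u := (starRingEnd ℂ) w with hu
    have hun : ‖u‖ < 1 := by rwa [hu, Complex.norm_conj]
    have hne : ∀ z ∈ closedBall (0 : ℂ) 1, 1 - u * z ≠ 0 := by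
      intro z hz h
      rw [sub_eq_zero] at h
      have h2 := congrArg norm h
      have hz1 : ‖z‖ ≤ 1 := by simpa using hz
      rw [norm_mul, norm_one] at h2
      nlinarith [norm_nonneg u, norm_nonneg z]
    obtain ⟨a, b, h1, h2, h3, h4, h5, h6⟩ := Fac.of_one_sub hun.le
    refine ⟨fun z => (z - w) / (1 - u * z) * a z, b, ?_, h2, ?_, h4, ?_, ?_⟩
    · exact (ContinuousOn.div (by fun_prop) (by fun_prop) hne).mul h1
    · exact (DifferentiableOn.div (by fun_prop) (by fun_prop)
        fun z hz => hne z (ball_subset_closedBall hz)).mul h3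
    · intro z hz
      have := h5 z hz
      have h' := hne z hz
      rw [mul_assoc, ← this, div_mul_cancel₀ _ h']
    · intro z hz
      have hz1 : ‖z‖ = 1 := by simpa using hz
      have h' := hne z (sphere_subset_closedBall hz)
      have h7 : z * (starRingEnd ℂ) z = 1 := by
        rw [Complex.mul_conj, Complex.normSq_eq_norm_sq, hz1]; simp
      have h8 : ‖z - w‖ = ‖1 - u * z‖ := by
        have : 1 - u * z = z * (starRingEnd ℂ) (z - w) := by
          rw [map_sub, ← hu]; linear_combination -h7
        rw [this, norm_mul, hz1, one_mul, Complex.norm_conj]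
      rw [norm_mul, norm_div, h8, div_self (norm_ne_zero_iff.2 h'), one_mul, h6 z hz]

lemma Fac.poly (p : Polynomial ℂ) : Fac (fun z => p.eval z) := by
  have hs := IsAlgClosed.splits p
  have h1 := hs.eq_prod_roots
  have h2 : ∀ s : Multiset ℂ, Fac (fun z => ((s.map (fun a => Polynomial.X - Polynomial.C a)).prod).eval z) := by
    intro s
    induction s using Multiset.induction_on with
    | empty => simpa using Fac.const 1
    | cons w s ih => simpa using (Fac.linear w).mul ih
  have h3 := (Fac.const p.leadingCoeff).mul (h2 p.roots)
  rw [h1]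
  simpa using h3

/-- `c` is the sequence of power series coefficients of `g` on the unit disc. -/
def HasCoeff (g : ℂ → ℂ) (c : ℕ → ℂ) : Prop :=
  ∀ z ∈ ball (0 : ℂ) 1, HasSum (fun n => c n * z ^ n) (g z)

lemma exists_coeff {g : ℂ → ℂ} (hg : DifferentiableOn ℂ g (ball 0 1)) : ∃ c, HasCoeff g c := by
  refine ⟨fun n => (n.factorial : ℂ)⁻¹ * iteratedDeriv n g 0, fun z hz => ?_⟩
  have := Complex.hasSum_taylorSeries_on_ball hg hz
  convert! this using 2 with n
  simp only [sub_zero, smul_eq_mul]; ring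

lemma HasCoeff.summable {g : ℂ → ℂ} {c : ℕ → ℂ} (h : HasCoeff g c) {r : ℝ} (h0 : 0 ≤ r)
    (h1 : r < 1) : Summable fun n => ‖c n * (r : ℂ) ^ n‖ :=
  ((h r (by simpa [abs_of_nonneg h0] using h1)).summable).norm

lemma mem_ball_mul {r : ℝ} (h0 : 0 ≤ r) (h1 : r < 1) {ζ : ℂ} (hζ : ζ ∈ sphere (0 : ℂ) 1) :
    (r : ℂ) * ζ ∈ ball (0 : ℂ) 1 := by
  have : ‖ζ‖ = 1 := by simpa using hζ
  simpa [this, abs_of_nonneg h0] using h1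

lemma HasCoeff.parseval {g : ℂ → ℂ} {c : ℕ → ℂ} (h : HasCoeff g c) {r : ℝ} (h0 : 0 ≤ r)
    (h1 : r < 1) :
    HasSum (fun n => ‖c n * (r : ℂ) ^ n‖ ^ 2) (∫ ζ, ‖g (r * ζ)‖ ^ 2 ∂circleMeasure) := by
  refine cm_parseval (h.summable h0 h1) fun ζ hζ => ?_
  have := h _ (mem_ball_mul h0 h1 hζ)
  simpa only [mul_pow, mul_assoc] using this

lemma HasCoeff.unique {g : ℂ → ℂ} {c d : ℕ → ℂ} (hc : HasCoeff g c) (hd : HasCoeff g d) :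
    c = d := by
  have h : HasCoeff (fun _ => 0) (fun n => c n - d n) := by
    intro z hz
    have := (hc z hz).sub (hd z hz)
    simpa [sub_mul] using this
  have h2 := h.parseval (r := 1/2) (by norm_num) (by norm_num)
  simp only [norm_zero, ne_eq, OfNat.ofNat_ne_zero, not_false_eq_true, zero_pow, integral_zero] at h2
  rw [hasSum_zero_iff_of_nonneg (fun n => by positivity)] at h2
  funext n
  have := congrFun h2 n
  simpa [sub_eq_zero] using this

lemma HasCoeff.mul {g k : ℂ → ℂ} {c d : ℕ → ℂ} (hc : HasCoeff g c) (hd : HasCoeff k d) :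
    HasCoeff (fun z => g z * k z)
      (fun n => ∑ ij ∈ Finset.HasAntidiagonal.antidiagonal n, c ij.1 * d ij.2) := by
  intro z hz
  have h1 := (hc z hz).summable.norm
  have h2 := (hd z hz).summable.norm
  have h3 := tsum_mul_tsum_eq_tsum_sum_antidiagonal_of_summable_norm h1 h2
  have h4 := (summable_norm_sum_mul_antidiagonal_of_summable_norm h1 h2).of_norm
  rw [(hc z hz).tsum_eq, (hd z hz).tsum_eq] at h3
  have h5 := h4.hasSum
  rw [← h3] at h5
  convert! h5 using 2 with n
  rw [Finset.sum_mul]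
  refine Finset.sum_congr rfl fun ij hij => ?_
  rw [← Finset.HasAntidiagonal.mem_antidiagonal.1 hij, pow_add]; ring

lemma HasCoeff.poly (p : Polynomial ℂ) : HasCoeff (fun z => p.eval z) p.coeff := by
  intro z _
  simp only [Polynomial.eval_eq_sum_range]
  apply hasSum_sum_of_ne_finset_zero
  intro n hn
  rw [Polynomial.coeff_eq_zero_of_natDegree_lt, zero_mul]
  simpa using hn

lemma coeff_bound {a : ℂ → ℂ} (ha : ContinuousOn a (closedBall 0 1)) {c : ℕ → ℂ}
    (hc : HasCoeff a c) (N : ℕ) :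
    ∑ n ∈ Finset.range N, ‖c n‖ ^ 2 ≤ ∫ ζ, ‖a ζ‖ ^ 2 ∂circleMeasure := by
  obtain ⟨C, hC⟩ := (isCompact_closedBall (0 : ℂ) 1).exists_bound_of_continuousOn ha
  have hev : ∀ᶠ r : ℝ in nhdsWithin 1 (Iio 1), r ∈ Ioo (0 : ℝ) 1 :=
    Ioo_mem_nhdsLT (by norm_num)
  have h1 : Filter.Tendsto (fun r : ℝ => ∫ ζ, ‖a (r * ζ)‖ ^ 2 ∂circleMeasure)
      (nhdsWithin 1 (Iio 1)) (nhds (∫ ζ, ‖a ζ‖ ^ 2 ∂circleMeasure)) := by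
    refine tendsto_integral_filter_of_dominated_convergence (fun _ => C ^ 2) ?_ ?_
      (integrable_const _) ?_
    · filter_upwards [hev] with r hr
      refine (cm_integrable ?_).aestronglyMeasurable
      refine ((ha.comp (by fun_prop) ?_).norm).pow 2
      intro ζ hζ
      exact ball_subset_closedBall (mem_ball_mul hr.1.le hr.2 hζ)
    · filter_upwards [hev] with r hr
      filter_upwards [cm_ae] with ζ hζ
      have := hC _ (ball_subset_closedBall (mem_ball_mul hr.1.le hr.2 hζ))
      rw [Real.norm_of_nonneg (by positivity)]
      gcongr
    · filter_upwards [cm_ae] with ζ hζ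
      have h2 := ha ζ (sphere_subset_closedBall hζ)
      refine ((h2.tendsto.comp (tendsto_nhdsWithin_iff.2 ⟨?_, ?_⟩)).norm).pow 2
      · have : Continuous (fun r : ℝ => (r : ℂ) * ζ) := by fun_prop
        have h3 := this.tendsto 1
        simp only [ofReal_one, one_mul] at h3
        exact h3.mono_left nhdsWithin_le_nhds
      · filter_upwards [hev] with r hr
        exact ball_subset_closedBall (mem_ball_mul hr.1.le hr.2 hζ)
  have h2 : Filter.Tendsto (fun r : ℝ => ∑ n ∈ Finset.range N, ‖c n * (r : ℂ) ^ n‖ ^ 2)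
      (nhdsWithin 1 (Iio 1)) (nhds (∑ n ∈ Finset.range N, ‖c n‖ ^ 2)) := by
    have : Continuous (fun r : ℝ => ∑ n ∈ Finset.range N, ‖c n * (r : ℂ) ^ n‖ ^ 2) := by fun_prop
    have h3 := this.tendsto 1
    simp only [ofReal_one, one_pow, mul_one] at h3
    exact h3.mono_left nhdsWithin_le_nhds
  refine le_of_tendsto_of_tendsto h2 h1 ?_
  filter_upwards [hev] with r hr
  have := hc.parseval hr.1.le hr.2
  rw [← this.tsum_eq]
  exact this.summable.sum_le_tsum _ (fun _ _ => by positivity)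

/-- Coefficient factorization of a polynomial. -/
lemma poly_fac (p : Polynomial ℂ) : ∃ a b : ℕ → ℂ,
    (∀ n, p.coeff n = ∑ ij ∈ Finset.HasAntidiagonal.antidiagonal n, a ij.1 * b ij.2) ∧
    (∀ N, ∑ n ∈ Finset.range N, ‖a n‖ ^ 2 ≤ ∫ ζ, ‖p.eval ζ‖ ∂circleMeasure) ∧
    (∀ N, ∑ n ∈ Finset.range N, ‖b n‖ ^ 2 ≤ ∫ ζ, ‖p.eval ζ‖ ∂circleMeasure) := by
  obtain ⟨a, b, h1, h2, h3, h4, h5, h6⟩ := Fac.poly p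
  have h5 : ∀ z ∈ closedBall (0 : ℂ) 1, p.eval z = a z * b z := h5
  obtain ⟨c, hc⟩ := exists_coeff h3
  obtain ⟨d, hd⟩ := exists_coeff h4
  refine ⟨c, d, ?_, ?_, ?_⟩
  · have h7 : HasCoeff (fun z => p.eval z)
        (fun n => ∑ ij ∈ Finset.HasAntidiagonal.antidiagonal n, c ij.1 * d ij.2) := fun z hz => by
      have := (hc.mul hd) z hz
      have h8 : a z * b z = p.eval z := (h5 z (ball_subset_closedBall hz)).symm
      beta_reduce at this ⊢
      rwa [h8] at this
    intro n
    exact congrFun ((HasCoeff.poly p).unique h7) n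
  · intro N
    refine (coeff_bound h1 hc N).trans (le_of_eq (integral_congr_ae ?_))
    filter_upwards [cm_ae] with ζ hζ
    rw [h5 ζ (sphere_subset_closedBall hζ), norm_mul, ← h6 ζ hζ, pow_two]
  · intro N
    refine (coeff_bound h2 hd N).trans (le_of_eq (integral_congr_ae ?_))
    filter_upwards [cm_ae] with ζ hζ
    rw [h5 ζ (sphere_subset_closedBall hζ), norm_mul, h6 ζ hζ, pow_two]


lemma cont_dilate {h : ℂ → ℂ} (hh : DifferentiableOn ℂ h (ball 0 1)) {r : ℝ} (h0 : 0 ≤ r)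
    (h1 : r < 1) : ContinuousOn (fun ζ => h (r * ζ)) (sphere (0 : ℂ) 1) :=
  hh.continuousOn.comp (by fun_prop) fun _ hζ => mem_ball_mul h0 h1 hζ

lemma hardy_real {h : ℂ → ℂ} (hh : DifferentiableOn ℂ h (ball 0 1))
    (hH1 : hardyNorm 1 h ≠ ⊤) {r : ℝ} (hr : r ∈ Ioo (0 : ℝ) 1) :
    ∫ ζ, ‖h (r * ζ)‖ ∂circleMeasure ≤ (hardyNorm 1 h).toReal := by
  rw [integral_eq_lintegral_of_nonneg_ae (Filter.Eventually.of_forall fun _ => norm_nonneg _)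
    (cm_integrable (cont_dilate hh hr.1.le hr.2).norm).aestronglyMeasurable]
  refine ENNReal.toReal_mono hH1 ?_
  unfold hardyNorm
  have := le_iSup₂ (f := fun (r : ℝ) (_ : r ∈ Ioo (0 : ℝ) 1) =>
    ∫⁻ ζ, ENNReal.ofReal (‖h (↑r * ζ)‖ ^ (1 : ℝ)) ∂circleMeasure) r hr
  simpa using this

lemma poly_approx {h : ℂ → ℂ} {c : ℕ → ℂ}
    (hc : HasCoeff h c) {M : ℝ}
    (hM : ∀ r ∈ Ioo (0 : ℝ) 1, ∫ ζ, ‖h (r * ζ)‖ ∂circleMeasure ≤ M) (k : ℕ)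
    {r : ℝ} (hr : r ∈ Ioo (0 : ℝ) 1) :
    ∃ p : Polynomial ℂ, ∫ ζ, ‖p.eval ζ‖ ∂circleMeasure ≤ M + 1 ∧
      ∀ n < k, p.coeff n = c n * (r : ℂ) ^ n := by
  let P : ℕ → Polynomial ℂ := fun N =>
    ∑ n ∈ Finset.range N, Polynomial.monomial n (c n * (r : ℂ) ^ n)
  have hP : ∀ N ζ, (P N).eval ζ = ∑ n ∈ Finset.range N, (c n * (r : ℂ) ^ n) * ζ ^ n := by
    intro N ζ
    simp [P, Polynomial.eval_finsetSum]
  have h1 : Filter.Tendsto (fun N => ∫ ζ, ‖(P N).eval ζ‖ ∂circleMeasure) Filter.atTop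
      (nhds (∫ ζ, ‖h (r * ζ)‖ ∂circleMeasure)) := by
    have hs := hc.summable hr.1.le hr.2
    refine tendsto_integral_of_dominated_convergence (fun _ => ∑' n, ‖c n * (r : ℂ) ^ n‖)
      ?_ (integrable_const _) ?_ ?_
    · intro N
      exact (cm_integrable (by fun_prop)).aestronglyMeasurable
    · intro N
      filter_upwards [cm_ae] with ζ hζ
      have hζn : ‖ζ‖ = 1 := by simpa using hζ
      rw [norm_norm, hP]
      refine (norm_sum_le _ _).trans ?_
      simp only [norm_mul _ (ζ ^ _), norm_pow ζ, hζn, one_pow, mul_one]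
      exact hs.sum_le_tsum _ (fun _ _ => norm_nonneg _)
    · filter_upwards [cm_ae] with ζ hζ
      have := hc _ (mem_ball_mul hr.1.le hr.2 hζ)
      simp only [mul_pow, ← mul_assoc] at this
      simp only [hP]
      exact this.tendsto_sum_nat.norm
  have h2 := (h1.eventually_lt_const (show _ < M + 1 by linarith [hM r hr])).and
    (Filter.eventually_ge_atTop k)
  obtain ⟨N, hN, hNk⟩ := h2.exists
  refine ⟨P N, hN.le, fun n hn => ?_⟩
  simp only [P, Polynomial.finsetSum_coeff, Polynomial.coeff_monomial]
  rw [Finset.sum_ite_eq', if_pos]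
  simp; omega

lemma H1_fac {h : ℂ → ℂ} {c : ℕ → ℂ}
    (hc : HasCoeff h c) {M : ℝ}
    (hM : ∀ r ∈ Ioo (0 : ℝ) 1, ∫ ζ, ‖h (r * ζ)‖ ∂circleMeasure ≤ M) :
    ∃ a b : ℕ → ℂ, (∀ n, c n = ∑ ij ∈ Finset.HasAntidiagonal.antidiagonal n, a ij.1 * b ij.2) ∧
      (Summable fun n => ‖a n‖ ^ 2) ∧ (Summable fun n => ‖b n‖ ^ 2) := by
  let r : ℕ → ℝ := fun k => 1 - 1 / ((k : ℝ) + 2)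
  have hr : ∀ k, r k ∈ Ioo (0 : ℝ) 1 := by
    intro k
    have : (1 : ℝ) / ((k : ℝ) + 2) < 1 := by
      rw [div_lt_one (by positivity)]; linarith [(Nat.cast_nonneg k : (0 : ℝ) ≤ k)]
    have h2 : 0 < (1 : ℝ) / ((k : ℝ) + 2) := by positivity
    constructor <;> simp only [r] <;> linarith
  have hrt : Filter.Tendsto r Filter.atTop (nhds 1) := by
    have h1 : Filter.Tendsto (fun k : ℕ => (1 : ℝ) / ((k : ℝ) + 2)) Filter.atTop (nhds 0) := by
      apply Filter.Tendsto.const_div_atTop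
      exact Filter.tendsto_atTop_add_const_right _ _ tendsto_natCast_atTop_atTop
    have h2 := h1.const_sub 1
    rw [sub_zero] at h2
    exact h2
  choose P hP1 hP2 using fun k => poly_approx hc hM k (hr k)
  choose a b hab ha hb using fun k => poly_fac (P k)
  have hco : ∀ n, Filter.Tendsto (fun k => (P k).coeff n) Filter.atTop (nhds (c n)) := by
    intro n
    have h1 : Filter.Tendsto (fun k => c n * (r k : ℂ) ^ n) Filter.atTop (nhds (c n)) := by
      have : Continuous (fun x : ℝ => c n * (x : ℂ) ^ n) := by fun_prop
      have h2 := (this.tendsto 1).comp hrt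
      simp only [ofReal_one, one_pow, mul_one] at h2
      exact h2
    refine h1.congr' ?_
    filter_upwards [Filter.eventually_gt_atTop n] with k hk
    exact (hP2 k n hk).symm
  have bd : ∀ (x : ℕ → ℕ → ℂ), (∀ k N, ∑ n ∈ Finset.range N, ‖x k n‖ ^ 2 ≤ M + 1) →
      ∀ k n, ‖x k n‖ ≤ Real.sqrt (M + 1) := by
    intro x hx k n
    apply Real.le_sqrt_of_sq_le
    refine le_trans ?_ (hx k (n + 1))
    exact Finset.single_le_sum (f := fun n => ‖x k n‖ ^ 2) (fun _ _ => by positivity) (by simp)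
  have ha' : ∀ k N, ∑ n ∈ Finset.range N, ‖a k n‖ ^ 2 ≤ M + 1 := fun k N =>
    (ha k N).trans (hP1 k)
  have hb' : ∀ k N, ∑ n ∈ Finset.range N, ‖b k n‖ ^ 2 ≤ M + 1 := fun k N =>
    (hb k N).trans (hP1 k)
  have hK : IsCompact (Set.pi univ fun _ : ℕ => closedBall (0 : ℂ) (Real.sqrt (M + 1))) :=
    isCompact_univ_pi fun _ => isCompact_closedBall _ _
  obtain ⟨A, -, φ, hφ, hA⟩ := hK.isSeqCompact (x := a) (fun k n _ => by
    simpa using bd a ha' k n)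
  obtain ⟨B, -, ψ, hψ, hB⟩ := hK.isSeqCompact (x := b ∘ φ) (fun k n _ => by
    simpa using bd b hb' (φ k) n)
  rw [tendsto_pi_nhds] at hA hB
  have hA2 : ∀ n, Filter.Tendsto (fun k => a (φ (ψ k)) n) Filter.atTop (nhds (A n)) := fun n =>
    (hA n).comp hψ.tendsto_atTop
  have hB2 : ∀ n, Filter.Tendsto (fun k => b (φ (ψ k)) n) Filter.atTop (nhds (B n)) := fun n =>
    hB n
  have sm : ∀ (x : ℕ → ℕ → ℂ) (X : ℕ → ℂ), (∀ k N, ∑ n ∈ Finset.range N, ‖x k n‖ ^ 2 ≤ M + 1) →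
      (∀ n, Filter.Tendsto (fun k => x (φ (ψ k)) n) Filter.atTop (nhds (X n))) →
      Summable fun n => ‖X n‖ ^ 2 := by
    intro x X hx hX
    refine summable_of_sum_range_le (c := M + 1) (fun _ => by positivity) fun N => ?_
    refine le_of_tendsto (x := Filter.atTop) (f := fun k => ∑ n ∈ Finset.range N, ‖x (φ (ψ k)) n‖ ^ 2)
      (tendsto_finsetSum _ fun n _ => ((hX n).norm).pow 2) (Filter.Eventually.of_forall fun k => hx _ N)
  refine ⟨A, B, fun n => ?_, sm a A ha' hA2, sm b B hb' hB2⟩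
  have h1 := (hco n).comp (hφ.tendsto_atTop.comp hψ.tendsto_atTop)
  have h2 : Filter.Tendsto (fun k => ∑ ij ∈ Finset.HasAntidiagonal.antidiagonal n,
      a (φ (ψ k)) ij.1 * b (φ (ψ k)) ij.2) Filter.atTop
      (nhds (∑ ij ∈ Finset.HasAntidiagonal.antidiagonal n, A ij.1 * B ij.2)) :=
    tendsto_finsetSum _ fun ij _ => (hA2 ij.1).mul (hB2 ij.2)
  refine tendsto_nhds_unique h1 (h2.congr fun k => ?_)
  exact (hab _ n).symm


lemma exists_seq : ∃ r : ℕ → ℝ, (∀ k, r k ∈ Ioo (0 : ℝ) 1) ∧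
    Filter.Tendsto r Filter.atTop (nhdsWithin 1 (Iio 1)) := by
  obtain ⟨u, -, h1, h2⟩ := exists_seq_strictMono_tendsto' (show (0 : ℝ) < 1 by norm_num)
  exact ⟨u, h1, tendsto_nhdsWithin_iff.2 ⟨h2, Filter.Eventually.of_forall fun k => (h1 k).2⟩⟩

lemma fatou {G : ℕ → ℂ → ℂ} {g : ℂ → ℂ} (hG : ∀ k, AEStronglyMeasurable (G k) circleMeasure)
    (hg : ∀ᵐ ζ ∂circleMeasure, Filter.Tendsto (fun k => G k ζ) Filter.atTop (nhds (g ζ)))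
    {C : ℝ≥0∞} (hC : ∀ᶠ k in Filter.atTop, ∫⁻ ζ, ‖G k ζ‖ₑ ∂circleMeasure ≤ C) :
    ∫⁻ ζ, ‖g ζ‖ₑ ∂circleMeasure ≤ C := by
  have h1 : ∫⁻ ζ, ‖g ζ‖ₑ ∂circleMeasure
      = ∫⁻ ζ, Filter.liminf (fun k => ‖G k ζ‖ₑ) Filter.atTop ∂circleMeasure := by
    apply lintegral_congr_ae
    filter_upwards [hg] with ζ hζ
    exact (hζ.enorm.liminf_eq).symm
  rw [h1]
  refine (lintegral_liminf_le' fun k => (hG k).enorm).trans ?_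
  exact Filter.liminf_le_of_frequently_le' hC.frequently

lemma HasCoeff.cont {g : ℂ → ℂ} {c : ℕ → ℂ} (h : HasCoeff g c) {r : ℝ} (h0 : 0 ≤ r)
    (h1 : r < 1) : ContinuousOn (fun ζ => g (r * ζ)) (sphere (0 : ℂ) 1) := by
  have h2 : ContinuousOn (fun ζ => ∑' n, (c n * (r : ℂ) ^ n) * ζ ^ n) (sphere (0 : ℂ) 1) := by
    refine continuousOn_tsum (fun n => by fun_prop) (h.summable h0 h1) ?_
    intro n ζ hζ
    have hζn : ‖ζ‖ = 1 := by simpa using hζ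
    rw [norm_mul _ (ζ ^ n), norm_pow ζ, hζn, one_pow, mul_one]
  refine h2.congr fun ζ hζ => ?_
  have := h _ (mem_ball_mul h0 h1 hζ)
  simp only [mul_pow, ← mul_assoc] at this
  exact this.tsum_eq.symm

lemma hasCoeff_of_sq {a : ℕ → ℂ} (ha : Summable fun n => ‖a n‖ ^ 2) :
    HasCoeff (fun z => ∑' n, a n * z ^ n) a := by
  intro z hz
  have hz1 : ‖z‖ < 1 := by simpa using hz
  apply Summable.hasSum
  apply Summable.of_norm
  have hg : Summable fun n => (‖z‖ ^ 2) ^ n :=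
    summable_geometric_of_lt_one (by positivity) (by nlinarith [norm_nonneg z])
  refine Summable.of_nonneg_of_le (fun _ => norm_nonneg _) (fun n => ?_) (ha.add hg)
  rw [norm_mul, norm_pow, ← pow_mul, mul_comm 2 n, pow_mul]
  nlinarith [sq_nonneg (‖a n‖ - ‖z‖ ^ n), sq_nonneg (‖a n‖), sq_nonneg (‖z‖ ^ n)]

/-- The `L²` tail. -/
noncomputable def tailE (a : ℕ → ℂ) (ρ : ℝ) : ℝ := ∑' n, ‖a n‖ ^ 2 * (1 - ρ ^ n) ^ 2

lemma tail_summable {a : ℕ → ℂ} (ha : Summable fun n => ‖a n‖ ^ 2) {ρ : ℝ} (h0 : 0 ≤ ρ)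
    (h1 : ρ ≤ 1) : Summable fun n => ‖a n‖ ^ 2 * (1 - ρ ^ n) ^ 2 := by
  refine Summable.of_nonneg_of_le (fun _ => by positivity) (fun n => ?_) ha
  have h2 : ρ ^ n ≤ 1 := pow_le_one₀ h0 h1
  have h3 : 0 ≤ ρ ^ n := by positivity
  have : (1 - ρ ^ n) ^ 2 ≤ 1 := by nlinarith
  exact mul_le_of_le_one_right (by positivity) this

lemma tail_tendsto {a : ℕ → ℂ} (ha : Summable fun n => ‖a n‖ ^ 2) :
    Filter.Tendsto (tailE a) (nhdsWithin 1 (Iio 1)) (nhds 0) := by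
  have h : Filter.Tendsto (tailE a) (nhdsWithin 1 (Iio 1)) (nhds (∑' _ : ℕ, (0 : ℝ))) := by
    unfold tailE
    refine tendsto_tsum_of_dominated_convergence ha ?_ ?_
    · intro n
      have : Continuous (fun ρ : ℝ => ‖a n‖ ^ 2 * (1 - ρ ^ n) ^ 2) := by fun_prop
      have h3 := this.tendsto 1
      simp only [one_pow, sub_self, ne_eq, OfNat.ofNat_ne_zero, not_false_eq_true, zero_pow,
        mul_zero] at h3
      exact h3.mono_left nhdsWithin_le_nhds
    · filter_upwards [Ioo_mem_nhdsLT (show (0 : ℝ) < 1 by norm_num)] with ρ hρ n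
      have h2 : ρ ^ n ≤ 1 := pow_le_one₀ hρ.1.le hρ.2.le
      have h3 : 0 ≤ ρ ^ n := pow_nonneg hρ.1.le n
      have : (1 - ρ ^ n) ^ 2 ≤ 1 := by nlinarith
      rw [Real.norm_of_nonneg (by positivity)]
      exact mul_le_of_le_one_right (by positivity) this
  simpa using h

lemma HasCoeff.l2_le {g : ℂ → ℂ} {a : ℕ → ℂ} (h : HasCoeff g a)
    (ha : Summable fun n => ‖a n‖ ^ 2) {ρ : ℝ} (h0 : 0 ≤ ρ) (h1 : ρ < 1) :
    ∫ ζ, ‖g (ρ * ζ)‖ ^ 2 ∂circleMeasure ≤ ∑' n, ‖a n‖ ^ 2 := by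
  refine hasSum_le (fun n => ?_) (h.parseval h0 h1) ha.hasSum
  rw [norm_mul, norm_pow, mul_pow]
  have : ‖(ρ : ℂ)‖ ≤ 1 := by simpa [abs_of_nonneg h0] using h1.le
  exact mul_le_of_le_one_right (by positivity) (pow_le_one₀ (by positivity)
    (pow_le_one₀ (norm_nonneg _) this))

lemma HasCoeff.l2_diff {g : ℂ → ℂ} {a : ℕ → ℂ} (h : HasCoeff g a)
    (ha : Summable fun n => ‖a n‖ ^ 2) {ρ σ : ℝ} (h0 : 0 ≤ ρ) (h1 : ρ ≤ σ) (h2 : σ < 1) :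
    ∫ ζ, ‖g (σ * ζ) - g (ρ * ζ)‖ ^ 2 ∂circleMeasure ≤ tailE a ρ := by
  have hs : Summable fun n => ‖a n * (σ : ℂ) ^ n - a n * (ρ : ℂ) ^ n‖ :=
    (((h.summable (h0.trans h1) h2).of_norm).sub
      ((h.summable h0 (h1.trans_lt h2)).of_norm)).norm
  have hp := cm_parseval hs (g := fun ζ => g (σ * ζ) - g (ρ * ζ)) (fun ζ hζ => by
    have e1 := h _ (mem_ball_mul (h0.trans h1) h2 hζ)
    have e2 := h _ (mem_ball_mul h0 (h1.trans_lt h2) hζ)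
    have e3 := e1.sub e2
    simpa only [mul_pow, ← mul_assoc, ← sub_mul] using e3)
  refine hasSum_le (fun n => ?_) hp (tail_summable ha h0 (h1.trans h2.le)).hasSum
  rw [← mul_sub, norm_mul, mul_pow]
  have h3 : ‖(σ : ℂ) ^ n - (ρ : ℂ) ^ n‖ = σ ^ n - ρ ^ n := by
    have : (σ : ℂ) ^ n - (ρ : ℂ) ^ n = ((σ ^ n - ρ ^ n : ℝ) : ℂ) := by push_cast; rfl
    rw [this, Complex.norm_real, Real.norm_of_nonneg]
    exact sub_nonneg.2 (pow_le_pow_left₀ h0 h1 n)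
  rw [h3]
  have h4 : ρ ^ n ≤ σ ^ n := pow_le_pow_left₀ h0 h1 n
  have h5 : σ ^ n ≤ 1 := pow_le_one₀ (h0.trans h1) h2.le
  gcongr

lemma amgm {x y ε : ℝ} (hε : 0 < ε) : x * y ≤ ε * x ^ 2 + ε⁻¹ * y ^ 2 := by
  have h1 : (ε * x - y) ^ 2 ≥ 0 := sq_nonneg _
  have h2 : ε⁻¹ * (ε * x - y) ^ 2 ≥ 0 := by positivity
  have h3 : ε⁻¹ * (ε * x - y) ^ 2 = ε * x ^ 2 + ε⁻¹ * y ^ 2 - 2 * (x * y) := by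
    field_simp; ring
  have h4 : 0 ≤ ε * x ^ 2 + ε⁻¹ * y ^ 2 := by positivity
  linarith

lemma l1_conv {h hs : ℂ → ℂ} (hh : DifferentiableOn ℂ h (ball 0 1))
    (hH1 : hardyNorm 1 h ≠ ⊤) (hbh : IsBoundaryFn h hs) {δ : ℝ} (hδ : 0 < δ) :
    ∀ᶠ ρ : ℝ in nhdsWithin 1 (Iio 1),
      ∫⁻ ζ, ‖h (ρ * ζ) - hs ζ‖ₑ ∂circleMeasure ≤ ENNReal.ofReal δ := by
  obtain ⟨c, hc⟩ := exists_coeff hh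
  obtain ⟨a, b, hab, ha, hb⟩ := H1_fac hc (fun r hr => hardy_real hh hH1 hr)
  set α : ℂ → ℂ := fun z => ∑' n, a n * z ^ n
  set β : ℂ → ℂ := fun z => ∑' n, b n * z ^ n
  have hα : HasCoeff α a := hasCoeff_of_sq ha
  have hβ : HasCoeff β b := hasCoeff_of_sq hb
  have hprod : ∀ z ∈ ball (0 : ℂ) 1, h z = α z * β z := by
    intro z hz
    have h1 := hα.mul hβ z hz
    simp only [← hab] at h1
    exact (hc z hz).unique h1
  set S : ℝ := (∑' n, ‖a n‖ ^ 2) + ∑' n, ‖b n‖ ^ 2 with hS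
  have hS0 : 0 ≤ S := add_nonneg (tsum_nonneg fun _ => by positivity)
    (tsum_nonneg fun _ => by positivity)
  set ε : ℝ := δ / (2 * (S + 1)) with hεd
  have hε : 0 < ε := by positivity
  have hεS : ε * S ≤ δ / 2 := by
    rw [hεd, div_mul_eq_mul_div, div_le_div_iff₀ (by positivity) (by positivity)]
    nlinarith
  have hE : Filter.Tendsto (fun ρ => ε⁻¹ * (tailE a ρ + tailE b ρ)) (nhdsWithin 1 (Iio 1))
      (nhds 0) := by
    simpa using ((tail_tendsto ha).add (tail_tendsto hb)).const_mul ε⁻¹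
  filter_upwards [hE.eventually_le_const (show (0 : ℝ) < δ / 2 by positivity),
    Ioo_mem_nhdsLT (show (0 : ℝ) < 1 by norm_num)] with ρ hρE hρ
  obtain ⟨r, hr, hrt⟩ := exists_seq
  refine fatou (G := fun k ζ => h (ρ * ζ) - h (r k * ζ)) (fun k => ?_) ?_ ?_
  · exact (cm_integrable ((cont_dilate hh hρ.1.le hρ.2).sub
      (cont_dilate hh (hr k).1.le (hr k).2))).aestronglyMeasurable
  · filter_upwards [hbh] with ζ hζ
    exact (hζ.comp hrt).const_sub _
  · have hrt' : Filter.Tendsto r Filter.atTop (nhds 1) := hrt.mono_right nhdsWithin_le_nhds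
    filter_upwards [hrt'.eventually_const_le hρ.2] with k hk
    have hσ := hr k
    set σ := r k
    have cασ := hα.cont hσ.1.le hσ.2
    have cαρ := hα.cont hρ.1.le hρ.2
    have cβσ := hβ.cont hσ.1.le hσ.2
    have cβρ := hβ.cont hρ.1.le hρ.2
    have i1 : Integrable (fun ζ => ‖α (σ * ζ)‖ ^ 2) circleMeasure :=
      cm_integrable (cασ.norm.pow 2)
    have i2 : Integrable (fun ζ => ‖β (ρ * ζ)‖ ^ 2) circleMeasure :=
      cm_integrable (cβρ.norm.pow 2)
    have i3 : Integrable (fun ζ => ‖α (σ * ζ) - α (ρ * ζ)‖ ^ 2) circleMeasure :=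
      cm_integrable ((cασ.sub cαρ).norm.pow 2)
    have i4 : Integrable (fun ζ => ‖β (σ * ζ) - β (ρ * ζ)‖ ^ 2) circleMeasure :=
      cm_integrable ((cβσ.sub cβρ).norm.pow 2)
    have j1 : Integrable (fun ζ => ε * ‖α (σ * ζ)‖ ^ 2 + ε⁻¹ * ‖β (σ * ζ) - β (ρ * ζ)‖ ^ 2)
        circleMeasure := (i1.const_mul _).add (i4.const_mul _)
    have j2 : Integrable (fun ζ => ε * ‖β (ρ * ζ)‖ ^ 2 + ε⁻¹ * ‖α (σ * ζ) - α (ρ * ζ)‖ ^ 2)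
        circleMeasure := (i2.const_mul _).add (i3.const_mul _)
    have ci := cm_integrable ((cont_dilate hh hρ.1.le hρ.2).sub (cont_dilate hh hσ.1.le hσ.2))
    have e1 : ∫⁻ ζ, ‖h (ρ * ζ) - h (σ * ζ)‖ₑ ∂circleMeasure
        = ENNReal.ofReal (∫ ζ, ‖h (ρ * ζ) - h (σ * ζ)‖ ∂circleMeasure) :=
      (ofReal_integral_norm_eq_lintegral_enorm ci).symm
    rw [e1]
    apply ENNReal.ofReal_le_ofReal
    have e2 : ∫ ζ, ‖h (ρ * ζ) - h (σ * ζ)‖ ∂circleMeasure ≤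
        ∫ ζ, ((ε * ‖α (σ * ζ)‖ ^ 2 + ε⁻¹ * ‖β (σ * ζ) - β (ρ * ζ)‖ ^ 2) +
          (ε * ‖β (ρ * ζ)‖ ^ 2 + ε⁻¹ * ‖α (σ * ζ) - α (ρ * ζ)‖ ^ 2)) ∂circleMeasure := by
      refine integral_mono_ae ci.norm (j1.add j2) ?_
      filter_upwards [cm_ae] with ζ hζ
      have p1 := hprod _ (mem_ball_mul hρ.1.le hρ.2 hζ)
      have p2 := hprod _ (mem_ball_mul hσ.1.le hσ.2 hζ)
      have : h (ρ * ζ) - h (σ * ζ) = -(α (σ * ζ) * (β (σ * ζ) - β (ρ * ζ)) +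
          β (ρ * ζ) * (α (σ * ζ) - α (ρ * ζ))) := by
        rw [p1, p2]; ring
      rw [this, norm_neg]
      refine (norm_add_le _ _).trans ?_
      rw [norm_mul, norm_mul]
      exact add_le_add (amgm hε) (amgm hε)
    refine e2.trans ?_
    rw [integral_add j1 j2,
      integral_add (i1.const_mul _) (i4.const_mul _),
      integral_add (i2.const_mul _) (i3.const_mul _),
      integral_const_mul, integral_const_mul, integral_const_mul, integral_const_mul]
    have b1 := hα.l2_le ha hσ.1.le hσ.2
    have b2 := hβ.l2_le hb hρ.1.le hρ.2
    have b3 := hα.l2_diff ha hρ.1.le hk hσ.2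
    have b4 := hβ.l2_diff hb hρ.1.le hk hσ.2
    have hε' : 0 < ε⁻¹ := by positivity
    nlinarith [mul_le_mul_of_nonneg_left b1 hε.le, mul_le_mul_of_nonneg_left b2 hε.le,
      mul_le_mul_of_nonneg_left b3 hε'.le, mul_le_mul_of_nonneg_left b4 hε'.le]

lemma one_sub_ne {ζ w : ℂ} (hζ : ζ ∈ sphere (0 : ℂ) 1) :
    1 - ‖w‖ ≤ ‖1 - (starRingEnd ℂ) ζ * w‖ := by
  have hζn : ‖ζ‖ = 1 := by simpa using hζ
  have := norm_sub_norm_le (1 : ℂ) ((starRingEnd ℂ) ζ * w)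
  simpa [hζn] using this

lemma H1_cauchy {h hs : ℂ → ℂ} (hh : DifferentiableOn ℂ h (ball 0 1))
    (hH1 : hardyNorm 1 h ≠ ⊤) (hbh : IsBoundaryFn h hs) (hInt : Integrable hs circleMeasure)
    {w : ℂ} (hw : w ∈ ball (0 : ℂ) 1) :
    Integrable (fun ζ => hs ζ / (1 - (starRingEnd ℂ) ζ * w)) circleMeasure ∧
    ∫ ζ, hs ζ / (1 - (starRingEnd ℂ) ζ * w) ∂circleMeasure = h w := by
  have hw1 : ‖w‖ < 1 := by simpa using hw
  have hpos : 0 < 1 - ‖w‖ := by linarith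
  have hne : ∀ ζ ∈ sphere (0 : ℂ) 1, 1 - (starRingEnd ℂ) ζ * w ≠ 0 := fun ζ hζ h0 => by
    have := one_sub_ne (w := w) hζ
    rw [h0, norm_zero] at this
    linarith
  have hbd : ∀ ζ ∈ sphere (0 : ℂ) 1, ‖(1 - (starRingEnd ℂ) ζ * w)⁻¹‖ ≤ (1 - ‖w‖)⁻¹ := by
    intro ζ hζ
    rw [norm_inv]
    exact inv_anti₀ hpos (one_sub_ne (w := w) hζ)
  have hkc : ContinuousOn (fun ζ : ℂ => (1 - (starRingEnd ℂ) ζ * w)⁻¹) (sphere (0 : ℂ) 1) :=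
    ContinuousOn.inv₀ (by fun_prop) hne
  have hI : Integrable (fun ζ => hs ζ / (1 - (starRingEnd ℂ) ζ * w)) circleMeasure := by
    simp only [div_eq_mul_inv]
    refine hInt.mul_bdd (c := (1 - ‖w‖)⁻¹) (cm_integrable hkc).aestronglyMeasurable ?_
    filter_upwards [cm_ae] with ζ hζ using hbd ζ hζ
  refine ⟨hI, ?_⟩
  have hev : ∀ᶠ r : ℝ in nhdsWithin 1 (Iio 1), r ∈ Ioo (0 : ℝ) 1 :=
    Ioo_mem_nhdsLT (by norm_num)
  have t1 : Filter.Tendsto (fun ρ : ℝ => ∫ ζ, h (ρ * ζ) / (1 - (starRingEnd ℂ) ζ * w) ∂circleMeasure)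
      (nhdsWithin 1 (Iio 1))
      (nhds (∫ ζ, hs ζ / (1 - (starRingEnd ℂ) ζ * w) ∂circleMeasure)) := by
    refine tendsto_integral_of_L1 _ hI.1 ?_ ?_
    · filter_upwards [hev] with ρ hρ
      exact cm_integrable ((cont_dilate hh hρ.1.le hρ.2).div (by fun_prop) hne)
    · rw [ENNReal.tendsto_nhds_zero]
      intro e he
      obtain ⟨δ, hδ, hδe⟩ : ∃ δ : ℝ, 0 < δ ∧ ENNReal.ofReal (1 - ‖w‖)⁻¹ * ENNReal.ofReal δ ≤ e := by
        by_cases het : e = ⊤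
        · exact ⟨1, one_pos, by simp [het]⟩
        · refine ⟨(1 - ‖w‖) * e.toReal, mul_pos hpos (ENNReal.toReal_pos he.ne' het), ?_⟩
          rw [← ENNReal.ofReal_mul (by positivity), inv_mul_cancel_left₀ hpos.ne',
            ENNReal.ofReal_toReal het]
      filter_upwards [l1_conv hh hH1 hbh hδ] with ρ hρ
      refine le_trans ?_ ((mul_le_mul_right hρ _).trans hδe)
      rw [← lintegral_const_mul' _ _ ENNReal.ofReal_ne_top]
      apply lintegral_mono_ae
      filter_upwards [cm_ae] with ζ hζ
      rw [← sub_div, div_eq_mul_inv, enorm_mul, mul_comm]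
      gcongr
      rw [← ofReal_norm]
      exact ENNReal.ofReal_le_ofReal (hbd ζ hζ)
  have t2 : Filter.Tendsto (fun ρ : ℝ => h (ρ * w)) (nhdsWithin 1 (Iio 1)) (nhds (h w)) := by
    have h1 : ContinuousAt h w := hh.continuousOn.continuousAt (isOpen_ball.mem_nhds hw)
    have h2 : Filter.Tendsto (fun ρ : ℝ => (ρ : ℂ) * w) (nhdsWithin 1 (Iio 1)) (nhds w) := by
      have : Continuous (fun r : ℝ => (r : ℂ) * w) := by fun_prop
      have h3 := this.tendsto 1
      simp only [ofReal_one, one_mul] at h3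
      exact h3.mono_left nhdsWithin_le_nhds
    exact h1.tendsto.comp h2
  refine tendsto_nhds_unique t1 (t2.congr' ?_)
  filter_upwards [hev] with ρ hρ
  have hmap : ∀ z ∈ closedBall (0 : ℂ) 1, (ρ : ℂ) * z ∈ ball (0 : ℂ) 1 := by
    intro z hz
    have hz1 : ‖z‖ ≤ 1 := by simpa using hz
    simp only [mem_ball, dist_zero_right, norm_mul, Complex.norm_real, Real.norm_of_nonneg hρ.1.le]
    nlinarith [hρ.1, hρ.2, norm_nonneg z]
  refine (cm_cauchy (g := fun z => h (ρ * z)) ⟨?_, ?_⟩ hw).symm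
  · exact hh.comp (by fun_prop) fun z hz => hmap z (ball_subset_closedBall hz)
  · rw [closure_ball _ one_ne_zero]
    exact hh.continuousOn.comp (by fun_prop) hmap


lemma ker_ge {u z : ℂ} (hu : ‖u‖ ≤ 1) {R : ℝ} (hz : ‖z‖ ≤ R) : 1 - R ≤ ‖1 - u * z‖ := by
  have h1 := norm_sub_norm_le (1 : ℂ) (u * z)
  rw [norm_one, norm_mul] at h1
  have : ‖u‖ * ‖z‖ ≤ 1 * R := mul_le_mul hu hz (norm_nonneg _) zero_le_one
  linarith

lemma param_int {X : Type*} [MeasurableSpace X] {μ : Measure X} {φ u : X → ℂ}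
    (hφ : Integrable φ μ) (hu : AEStronglyMeasurable u μ) (hu1 : ∀ᵐ x ∂μ, ‖u x‖ ≤ 1)
    {z : ℂ} (hz : z ∈ ball (0 : ℂ) 1) : Integrable (fun x => φ x / (1 - u x * z)) μ := by
  have hz1 : ‖z‖ < 1 := by simpa using hz
  simp only [div_eq_mul_inv]
  refine hφ.mul_bdd (c := (1 - ‖z‖)⁻¹) ?_ ?_
  · exact ((hu.aemeasurable.mul_const z).const_sub 1).inv.aestronglyMeasurable
  · filter_upwards [hu1] with x hx
    rw [norm_inv]
    exact inv_anti₀ (by linarith) (ker_ge hx le_rfl)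

lemma param_diff {X : Type*} [MeasurableSpace X] {μ : Measure X} {φ u : X → ℂ}
    (hφ : Integrable φ μ) (hu : AEStronglyMeasurable u μ) (hu1 : ∀ᵐ x ∂μ, ‖u x‖ ≤ 1) :
    DifferentiableOn ℂ (fun z => ∫ x, φ x / (1 - u x * z) ∂μ) (ball (0 : ℂ) 1) := by
  intro z₀ hz₀
  have hz1 : ‖z₀‖ < 1 := by simpa using hz₀
  set R : ℝ := (1 + ‖z₀‖) / 2 with hR
  have hR1 : R < 1 := by rw [hR]; linarith
  have hzR : ‖z₀‖ < R := by rw [hR]; linarith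
  have hsub : ∀ z ∈ ball (0 : ℂ) R, z ∈ ball (0 : ℂ) 1 := fun z hz => ball_subset_ball hR1.le hz
  have hnb : ball (0 : ℂ) R ∈ nhds z₀ := isOpen_ball.mem_nhds (by simpa using hzR)
  refine (hasDerivAt_integral_of_dominated_loc_of_deriv_le (F := fun z x => φ x / (1 - u x * z))
    (F' := fun z x => φ x * (u x / (1 - u x * z) ^ 2))
    (bound := fun x => ‖φ x‖ * (1 / (1 - R) ^ 2)) hnb ?_ (param_int hφ hu hu1 hz₀) ?_ ?_
    (hφ.norm.mul_const _) ?_).2.differentiableAt.differentiableWithinAt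
  · filter_upwards [hnb] with z hz
    exact (param_int hφ hu hu1 (hsub z hz)).aestronglyMeasurable
  · refine (hφ.aemeasurable.mul (hu.aemeasurable.div ?_)).aestronglyMeasurable
    exact ((hu.aemeasurable.mul_const z₀).const_sub 1).pow_const 2
  · filter_upwards [hu1] with x hx z hz
    have hz' : ‖z‖ < R := by simpa using hz
    have h1 := ker_ge hx hz'.le
    rw [norm_mul, norm_div, norm_pow]
    have : 0 < 1 - R := by linarith
    gcongr
  · filter_upwards [hu1] with x hx z hz
    have hz' : ‖z‖ < R := by simpa using hz
    have h1 := ker_ge hx hz'.le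
    have hne : 1 - u x * z ≠ 0 := by
      intro h0; rw [h0, norm_zero] at h1; linarith
    have d1 : HasDerivAt (fun z => 1 - u x * z) (-(u x)) z := by
      simpa using ((hasDerivAt_id z).const_mul (u x)).const_sub 1
    have d2 : HasDerivAt (fun y => φ x * (1 - u x * y)⁻¹)
        (φ x * (-(-(u x)) / (1 - u x * z) ^ 2)) z := (d1.inv hne).const_mul (φ x)
    have e : φ x * (-(-(u x)) / (1 - u x * z) ^ 2) = φ x * (u x / (1 - u x * z) ^ 2) := by
      rw [neg_neg]
    rw [e] at d2
    simpa only [div_eq_mul_inv] using d2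

lemma conj_aesm : AEStronglyMeasurable (fun ζ : ℂ => (starRingEnd ℂ) ζ) circleMeasure :=
  Complex.continuous_conj.aestronglyMeasurable

lemma conj_ae : ∀ᵐ ζ : ℂ ∂circleMeasure, ‖(starRingEnd ℂ) ζ‖ ≤ 1 := by
  filter_upwards [cm_ae] with ζ hζ
  have hζn : ‖ζ‖ = 1 := by simpa using hζ
  rw [Complex.norm_conj, hζn]

lemma cm_rot {g : ℂ → ℝ} (hg : ContinuousOn g (sphere (0 : ℂ) 1)) {ω : ℂ} (hω : ‖ω‖ = 1) :
    ∫ ζ, g (ω * ζ) ∂circleMeasure = ∫ ζ, g ζ ∂circleMeasure := by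
  have hg2 : ContinuousOn (fun ζ => g (ω * ζ)) (sphere (0 : ℂ) 1) :=
    hg.comp (by fun_prop) fun ζ hζ => by
      have hζn : ‖ζ‖ = 1 := by simpa using hζ
      simp [hω, hζn]
  rw [cm_integral hg, cm_integral hg2, Real.circleAverage_eq_integral_add (f := g) (arg ω),
    Real.circleAverage_def]
  congr 1
  apply intervalIntegral.integral_congr
  intro θ _
  have : Complex.exp (arg ω * I) = ω := by
    have := Complex.norm_mul_exp_arg_mul_I ω
    rwa [hω, ofReal_one, one_mul] at this
  simp only [circleMap, zero_add, ofReal_one, one_mul]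
  rw [ofReal_add, add_mul, Complex.exp_add, this, mul_comm]

lemma mean_mono {φ : ℂ → ℂ} (hφ : Integrable φ circleMeasure) {Φ : ℂ → ℂ}
    (hΦ : Φ = fun z => ∫ ζ, φ ζ / (1 - (starRingEnd ℂ) ζ * z) ∂circleMeasure)
    {r R : ℝ} (h0 : 0 < r) (h1 : r < R) (h2 : R < 1) :
    ∫ η, ‖Φ (r * η)‖ ∂circleMeasure ≤ ∫ η, ‖Φ (R * η)‖ ∂circleMeasure := by
  have hd : DifferentiableOn ℂ Φ (ball (0 : ℂ) 1) := by
    rw [hΦ]; exact param_diff hφ conj_aesm conj_ae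
  have hr1 := h1.trans h2
  have hR0 := h0.trans h1
  have cr := cont_dilate hd h0.le hr1
  have cR := cont_dilate hd hR0.le h2
  let g : ℂ → ℂ := fun η => (starRingEnd ℂ) (Φ (r * η)) * ((‖Φ (r * η)‖⁻¹ : ℝ) : ℂ)
  have hgm : AEStronglyMeasurable g circleMeasure := by
    have m1 := (cm_integrable cr).aemeasurable
    refine (AEMeasurable.mul ?_ ?_).aestronglyMeasurable
    · exact Complex.continuous_conj.measurable.comp_aemeasurable m1
    · exact Complex.measurable_ofReal.comp_aemeasurable m1.norm.inv
  have hg1 : ∀ η, ‖g η‖ ≤ 1 := by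
    intro η
    simp only [g, norm_mul, Complex.norm_conj, Complex.norm_real, norm_inv, norm_norm]
    exact mul_inv_le_one
  have hgi : Integrable g circleMeasure :=
    Integrable.of_bound hgm 1 (Filter.Eventually.of_forall hg1)
  -- the auxiliary analytic function on the product space
  let G : ℂ → ℂ := fun z => ∫ x : ℂ × ℂ, (g x.1 * φ x.2) / (1 - (x.1 * (starRingEnd ℂ) x.2) * z)
    ∂(circleMeasure.prod circleMeasure)
  have hgφ : Integrable (fun x : ℂ × ℂ => g x.1 * φ x.2) (circleMeasure.prod circleMeasure) :=
    hgi.mul_prod hφ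
  have hum : AEStronglyMeasurable (fun x : ℂ × ℂ => x.1 * (starRingEnd ℂ) x.2)
      (circleMeasure.prod circleMeasure) := by
    apply Continuous.aestronglyMeasurable
    fun_prop
  have hu1 : ∀ᵐ x : ℂ × ℂ ∂(circleMeasure.prod circleMeasure),
      ‖x.1 * (starRingEnd ℂ) x.2‖ ≤ 1 := by
    filter_upwards [Measure.quasiMeasurePreserving_fst.ae cm_ae,
      Measure.quasiMeasurePreserving_snd.ae cm_ae] with x hx1 hx2
    have e1 : ‖x.1‖ = 1 := by simpa using hx1
    have e2 : ‖x.2‖ = 1 := by simpa using hx2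
    rw [norm_mul, Complex.norm_conj, e1, e2, one_mul]
  have hGd : DifferentiableOn ℂ G (ball (0 : ℂ) 1) := param_diff hgφ hum hu1
  have hG : ∀ z ∈ ball (0 : ℂ) 1, G z = ∫ η, g η * Φ (z * η) ∂circleMeasure := by
    intro z hz
    simp only [G]
    rw [integral_prod _ (param_int hgφ hum hu1 hz)]
    apply integral_congr_ae
    refine Filter.Eventually.of_forall fun η => ?_
    simp only [hΦ]
    rw [← integral_const_mul]
    apply integral_congr_ae
    refine Filter.Eventually.of_forall fun ζ => ?_
    simp only
    rw [mul_div_assoc]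
    congr 3
    ring
  have hGr : G r = ((∫ η, ‖Φ (r * η)‖ ∂circleMeasure : ℝ) : ℂ) := by
    rw [hG _ (by simpa [abs_of_pos h0] using hr1), ← integral_complex_ofReal]
    apply integral_congr_ae
    refine Filter.Eventually.of_forall fun η => ?_
    simp only [g]
    by_cases hz : Φ (r * η) = 0
    · simp [hz]
    · have : ((‖Φ (r * η)‖ : ℝ) : ℂ) ≠ 0 := by simpa using hz
      have e := Complex.mul_conj (Φ (r * η))
      rw [Complex.normSq_eq_norm_sq] at e
      push_cast at e ⊢
      field_simp
      linear_combination e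
  have hbound : ∀ z ∈ frontier (ball (0 : ℂ) R), ‖G z‖ ≤ ∫ η, ‖Φ (R * η)‖ ∂circleMeasure := by
    intro z hz
    rw [frontier_ball _ hR0.ne'] at hz
    have hzn : ‖z‖ = R := by simpa using hz
    obtain ⟨ω, hω, rfl⟩ : ∃ ω : ℂ, ‖ω‖ = 1 ∧ z = R * ω := by
      refine ⟨z / R, ?_, ?_⟩
      · rw [norm_div, hzn, Complex.norm_real, Real.norm_of_nonneg hR0.le, div_self hR0.ne']
      · have : (R : ℂ) ≠ 0 := by exact_mod_cast hR0.ne'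
        field_simp
    rw [hG _ (by simpa [hω, abs_of_pos hR0] using h2), ← cm_rot cR.norm hω]
    refine norm_integral_le_of_norm_le ?_ ?_
    · refine cm_integrable ((cR.norm).comp (g := fun ζ => ‖Φ (R * ζ)‖)
        (f := fun ζ => ω * ζ) (by fun_prop) fun ζ hζ => ?_)
      have hζn : ‖ζ‖ = 1 := by simpa using hζ
      simp [hω, hζn]
    · refine Filter.Eventually.of_forall fun η => ?_
      rw [norm_mul, mul_assoc]
      exact mul_le_of_le_one_left (norm_nonneg _) (hg1 η)
  have hmax := Complex.norm_le_of_forall_mem_frontier_norm_le (f := G) isBounded_ball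
    (DifferentiableOn.diffContOnCl (by
      rw [closure_ball _ hR0.ne']
      exact hGd.mono (closedBall_subset_ball h2))) hbound
    (z := (r : ℂ)) (subset_closure (by simpa [abs_of_pos h0] using h1))
  rw [hGr, Complex.norm_real] at hmax
  exact (le_abs_self _).trans hmax

lemma ker_compare {ζ η : ℂ} (hζ : ‖ζ‖ = 1) (hη : ‖η‖ = 1) {R : ℝ} :
    (1 + R) / 2 * ‖ζ - η‖ ≤ ‖1 - (starRingEnd ℂ) ζ * (R * η)‖ := by
  have h1 : ζ * (starRingEnd ℂ) ζ = 1 := by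
    rw [Complex.mul_conj, Complex.normSq_eq_norm_sq, hζ]; simp
  have h2 : η * (starRingEnd ℂ) η = 1 := by
    rw [Complex.mul_conj, Complex.normSq_eq_norm_sq, hη]; simp
  set X := 1 - (starRingEnd ℂ) ζ * (R * η) with hX
  have e1 : ‖ζ - R * η‖ = ‖X‖ := by
    have : ζ - R * η = ζ * X := by rw [hX]; linear_combination R * η * h1
    rw [this, norm_mul, hζ, one_mul]
  have e2 : ‖R * ζ - η‖ = ‖X‖ := by
    have : R * ζ - η = -(η * (starRingEnd ℂ) X) := by
      rw [hX]
      simp only [map_sub, map_one, map_mul, Complex.conj_conj, Complex.conj_ofReal]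
      linear_combination (-(R : ℂ) * ζ) * h2
    rw [this, norm_neg, norm_mul, hη, one_mul, Complex.norm_conj]
  have e3 : (1 + (R : ℂ)) * (ζ - η) = (ζ - R * η) + (R * ζ - η) := by ring
  have e4 := norm_add_le (ζ - R * η) (R * ζ - η)
  rw [← e3, e1, e2, norm_mul] at e4
  have e5 : (1 + R) ≤ ‖1 + (R : ℂ)‖ := by
    have : 1 + (R : ℂ) = ((1 + R : ℝ) : ℂ) := by push_cast; rfl
    rw [this, Complex.norm_real]; exact le_abs_self _
  nlinarith [mul_le_mul_of_nonneg_right e5 (norm_nonneg (ζ - η))]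

lemma ker_bound {ζ η d : ℂ} (hζ : ‖ζ‖ = 1) (hη : ‖η‖ = 1) (hd : ζ = η → d = 0) {R : ℝ}
    (hR : 0 < R) :
    ‖d‖ / ‖1 - (starRingEnd ℂ) ζ * (R * η)‖ ≤ 2 / (1 + R) * (‖d‖ / ‖ζ - η‖) := by
  by_cases h : ζ = η
  · simp [hd h]
  · have h1 : 0 < ‖ζ - η‖ := norm_pos_iff.2 (sub_ne_zero.2 h)
    have h2 := ker_compare hζ hη (R := R)
    have h3 : 0 < (1 + R) / 2 * ‖ζ - η‖ := by positivity
    calc _ ≤ ‖d‖ / ((1 + R) / 2 * ‖ζ - η‖) := by gcongr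
      _ = _ := by field_simp

lemma key_est {fs h hs : ℂ → ℂ} (hfs : AEStronglyMeasurable fs circleMeasure)
    {A : ℝ≥0∞} (hA : A ≠ ⊤) (hfA : ∀ᵐ ζ ∂circleMeasure, ‖fs ζ‖ₑ ≤ A)
    (hh : DifferentiableOn ℂ h (ball 0 1))
    (hH1 : hardyNorm 1 h ≠ ⊤) (hbh : IsBoundaryFn h hs) (hInt : Integrable hs circleMeasure)
    (hφ : Integrable (fun ζ => (starRingEnd ℂ) (fs ζ) * hs ζ) circleMeasure)
    {R : ℝ} (hR : R ∈ Ioo (0 : ℝ) 1) :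
    ∫⁻ η, ‖toeplitz fs hs (R * η)‖ₑ ∂circleMeasure ≤
      ENNReal.ofReal (2 / (1 + R)) * (Lam fs * ∫⁻ ζ, ‖hs ζ‖ₑ ∂circleMeasure) +
        A * ∫⁻ η, ‖h (R * η)‖ₑ ∂circleMeasure := by
  let K : ℂ → ℂ → ℝ≥0∞ := fun η ζ => ENNReal.ofReal (‖fs η - fs ζ‖ / ‖η - ζ‖) * ‖hs ζ‖ₑ
  have hpt : ∀ᵐ η ∂circleMeasure, ‖toeplitz fs hs (R * η)‖ₑ ≤
      ENNReal.ofReal (2 / (1 + R)) * ∫⁻ ζ, K η ζ ∂circleMeasure + A * ‖h (R * η)‖ₑ := by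
    filter_upwards [cm_ae, hfA] with η hη hηA
    have hηn : ‖η‖ = 1 := by simpa using hη
    have hw := mem_ball_mul hR.1.le hR.2 hη
    obtain ⟨i1, e1⟩ := H1_cauchy hh hH1 hbh hInt hw
    have i2 := param_int hφ conj_aesm conj_ae hw
    have e2 : toeplitz fs hs (R * η) =
        (∫ ζ, (starRingEnd ℂ) (fs ζ - fs η) * hs ζ / (1 - (starRingEnd ℂ) ζ * (R * η))
          ∂circleMeasure) + (starRingEnd ℂ) (fs η) * h (R * η) := by
      rw [← e1, ← integral_const_mul, ← sub_eq_iff_eq_add]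
      unfold toeplitz
      rw [← integral_sub i2 (i1.const_mul _)]
      apply integral_congr_ae
      refine Filter.Eventually.of_forall fun ζ => ?_
      simp only [map_sub]
      ring
    rw [e2]
    refine (enorm_add_le _ _).trans (add_le_add ?_ ?_)
    · refine (enorm_integral_le_lintegral_enorm _).trans ?_
      rw [← lintegral_const_mul' _ _ ENNReal.ofReal_ne_top]
      apply lintegral_mono_ae
      filter_upwards [cm_ae] with ζ hζ
      have hζn : ‖ζ‖ = 1 := by simpa using hζ
      have b := ker_bound (d := fs ζ - fs η) hζn hηn (fun e => by rw [e, sub_self]) hR.1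
      rw [mul_div_right_comm, enorm_mul]
      simp only [K]
      rw [← mul_assoc (ENNReal.ofReal (2 / (1 + R))),
        ← ENNReal.ofReal_mul (p := 2 / (1 + R)) (by have := hR.1; positivity)]
      gcongr
      rw [← ofReal_norm, norm_div, Complex.norm_conj, norm_sub_rev (fs η), norm_sub_rev η]
      exact ENNReal.ofReal_le_ofReal b
    · rw [enorm_mul]
      gcongr
      rwa [← ofReal_norm, Complex.norm_conj, ofReal_norm]
  have hKm : AEMeasurable (Function.uncurry K) (circleMeasure.prod circleMeasure) := by
    have m1 := hfs.aemeasurable.comp_quasiMeasurePreserving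
      (Measure.quasiMeasurePreserving_fst (μ := circleMeasure) (ν := circleMeasure))
    have m2 := hfs.aemeasurable.comp_quasiMeasurePreserving
      (Measure.quasiMeasurePreserving_snd (μ := circleMeasure) (ν := circleMeasure))
    have m3 := hInt.aemeasurable.comp_quasiMeasurePreserving
      (Measure.quasiMeasurePreserving_snd (μ := circleMeasure) (ν := circleMeasure))
    have m4 : AEMeasurable (fun x : ℂ × ℂ => ‖x.1 - x.2‖) (circleMeasure.prod circleMeasure) := by
      fun_prop
    exact (((m1.sub m2).norm.div m4).ennreal_ofReal).mul m3.enorm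
  have hswap : ∫⁻ η, ∫⁻ ζ, K η ζ ∂circleMeasure ∂circleMeasure ≤
      Lam fs * ∫⁻ ζ, ‖hs ζ‖ₑ ∂circleMeasure := by
    rw [lintegral_lintegral_swap hKm, ← lintegral_const_mul'' _ hInt.aestronglyMeasurable.enorm]
    apply lintegral_mono_ae
    have hess := ENNReal.ae_le_essSup (μ := circleMeasure) (fun η =>
      ∫⁻ ζ, ENNReal.ofReal (‖fs ζ - fs η‖ / ‖ζ - η‖) ∂circleMeasure)
    filter_upwards [hess] with ζ hζ
    simp only [K]
    rw [lintegral_mul_const' _ _ (by simp)]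
    gcongr
    exact hζ
  calc _ ≤ ∫⁻ η, (ENNReal.ofReal (2 / (1 + R)) * ∫⁻ ζ, K η ζ ∂circleMeasure +
        A * ‖h (R * η)‖ₑ) ∂circleMeasure := lintegral_mono_ae hpt
    _ = ENNReal.ofReal (2 / (1 + R)) * (∫⁻ η, ∫⁻ ζ, K η ζ ∂circleMeasure ∂circleMeasure) +
        A * ∫⁻ η, ‖h (R * η)‖ₑ ∂circleMeasure := by
      have m := (cm_integrable (cont_dilate hh hR.1.le hR.2)).aestronglyMeasurable.enorm
      rw [lintegral_add_right' _ (m.const_mul _), lintegral_const_mul' _ _ hA,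
        lintegral_const_mul' _ _ ENNReal.ofReal_ne_top]
    _ ≤ _ := by gcongr

lemma hardy_le {h : ℂ → ℂ} {r : ℝ} (hr : r ∈ Ioo (0 : ℝ) 1) :
    ∫⁻ ζ, ‖h (r * ζ)‖ₑ ∂circleMeasure ≤ hardyNorm 1 h := by
  unfold hardyNorm
  have := le_iSup₂ (f := fun (r : ℝ) (_ : r ∈ Ioo (0 : ℝ) 1) =>
    ∫⁻ ζ, ENNReal.ofReal (‖h (↑r * ζ)‖ ^ (1 : ℝ)) ∂circleMeasure) r hr
  simpa using this

theorem toeplitz_bounded_H1 (f fs : ℂ → ℂ)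
    (hf : DifferentiableOn ℂ f (Metric.ball (0 : ℂ) 1))
    (hfb : eSupAbs f ≠ ⊤)
    (hbf : IsBoundaryFn f fs)
    (hΛ : Lam fs ≠ ⊤)
    (h hs : ℂ → ℂ)
    (hh : DifferentiableOn ℂ h (Metric.ball (0 : ℂ) 1))
    (hH1 : hardyNorm 1 h ≠ ⊤)
    (hbh : IsBoundaryFn h hs)
    (hInt : Integrable hs circleMeasure) :
    DifferentiableOn ℂ (toeplitz fs hs) (Metric.ball (0 : ℂ) 1) ∧
      hardyNorm 1 (toeplitz fs hs) ≤ (eSupAbs f + Lam fs) * hardyNorm 1 h := by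
  obtain ⟨ρ, hρ, hρt⟩ := exists_seq
  have hfA0 : ∀ z ∈ ball (0 : ℂ) 1, ‖f z‖ₑ ≤ eSupAbs f := by
    intro z hz
    unfold eSupAbs
    have := le_iSup₂ (f := fun (z : ℂ) (_ : z ∈ ball (0 : ℂ) 1) => ENNReal.ofReal ‖f z‖) z hz
    simpa using this
  have hfs : AEStronglyMeasurable fs circleMeasure := by
    refine aestronglyMeasurable_of_tendsto_ae Filter.atTop (f := fun k ζ => f (ρ k * ζ))
      (fun k => (cm_integrable (cont_dilate hf (hρ k).1.le (hρ k).2)).aestronglyMeasurable) ?_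
    filter_upwards [hbf] with ζ hζ using hζ.comp hρt
  have hfA : ∀ᵐ ζ ∂circleMeasure, ‖fs ζ‖ₑ ≤ eSupAbs f := by
    filter_upwards [hbf, cm_ae] with ζ hζ hζ1
    refine le_of_tendsto' (hζ.comp hρt).enorm fun k => ?_
    exact hfA0 _ (mem_ball_mul (hρ k).1.le (hρ k).2 hζ1)
  have hφ : Integrable (fun ζ => (starRingEnd ℂ) (fs ζ) * hs ζ) circleMeasure := by
    refine hInt.bdd_mul (c := (eSupAbs f).toReal)
      (Complex.continuous_conj.comp_aestronglyMeasurable hfs) ?_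
    filter_upwards [hfA] with ζ hζ
    rw [Complex.norm_conj, ← toReal_enorm]
    exact ENNReal.toReal_mono hfb hζ
  have hd : DifferentiableOn ℂ (toeplitz fs hs) (ball (0 : ℂ) 1) :=
    param_diff hφ conj_aesm conj_ae
  refine ⟨hd, ?_⟩
  have hhs : ∫⁻ ζ, ‖hs ζ‖ₑ ∂circleMeasure ≤ hardyNorm 1 h := by
    refine fatou (G := fun k ζ => h (ρ k * ζ))
      (fun k => (cm_integrable (cont_dilate hh (hρ k).1.le (hρ k).2)).aestronglyMeasurable) ?_
      (Filter.Eventually.of_forall fun k => hardy_le (hρ k))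
    filter_upwards [hbh] with ζ hζ using hζ.comp hρt
  rw [hardyNorm]
  refine iSup₂_le fun r hr => ?_
  have hL : ∫⁻ ζ, ENNReal.ofReal (‖toeplitz fs hs (r * ζ)‖ ^ (1 : ℝ)) ∂circleMeasure
      = ∫⁻ ζ, ‖toeplitz fs hs (r * ζ)‖ₑ ∂circleMeasure := by
    simp
  rw [hL]
  have hRbound : ∀ R ∈ Ioo r 1, ∫⁻ ζ, ‖toeplitz fs hs (r * ζ)‖ₑ ∂circleMeasure ≤
      ENNReal.ofReal (2 / (1 + R)) * (Lam fs * hardyNorm 1 h) + eSupAbs f * hardyNorm 1 h := by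
    intro R hR
    have hR' : R ∈ Ioo (0 : ℝ) 1 := ⟨hr.1.trans hR.1, hR.2⟩
    have m1 := mean_mono hφ (Φ := toeplitz fs hs) rfl hr.1 hR.1 hR.2
    have m2 : ∫⁻ ζ, ‖toeplitz fs hs (r * ζ)‖ₑ ∂circleMeasure ≤
        ∫⁻ ζ, ‖toeplitz fs hs (R * ζ)‖ₑ ∂circleMeasure := by
      rw [← ofReal_integral_norm_eq_lintegral_enorm (cm_integrable (cont_dilate hd hr.1.le hr.2)),
        ← ofReal_integral_norm_eq_lintegral_enorm
          (cm_integrable (cont_dilate hd hR'.1.le hR'.2))]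
      exact ENNReal.ofReal_le_ofReal m1
    refine m2.trans ((key_est hfs hfb hfA hh hH1 hbh hInt hφ hR').trans ?_)
    gcongr
    exact hardy_le hR'
  have hlim : Filter.Tendsto (fun R : ℝ => ENNReal.ofReal (2 / (1 + R)) *
      (Lam fs * hardyNorm 1 h) + eSupAbs f * hardyNorm 1 h) (nhdsWithin 1 (Iio 1))
      (nhds (1 * (Lam fs * hardyNorm 1 h) + eSupAbs f * hardyNorm 1 h)) := by
    refine Filter.Tendsto.add (ENNReal.Tendsto.mul_const ?_ (Or.inl one_ne_zero))
      tendsto_const_nhds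
    have hc : ContinuousAt (fun R : ℝ => 2 / (1 + R)) 1 :=
      ContinuousAt.div (by fun_prop) (by fun_prop) (by norm_num)
    have h3 := ENNReal.tendsto_ofReal (hc.tendsto.mono_left
      (nhdsWithin_le_nhds (s := Iio (1 : ℝ))))
    norm_num at h3
    exact h3
  have := ge_of_tendsto hlim (Filter.mem_of_superset (Ioo_mem_nhdsLT hr.2) hRbound)
  refine this.trans (le_of_eq ?_)
  ring
end

section
/- (Theorem 2, membership in 𝔑.) Let α = (α_n)_{n≥0} be a monotone decreasing sequence of positive real numbers with nondecreasing successive differences (α_n − 2α_{n+1} + α_{n+2} ≥ 0 for all n), and suppose ‖α‖ := ∑_{n≥0} α_n/(n+1) < ∞. Then for every f ∈ H^∞, the function f*α belongs to 𝔑 and ‖f*α‖_𝔑 = ‖f*α‖_{H^∞} + Λ(f*α) ≤ 12 ‖f‖_{H^∞} ‖α‖. -/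
open MeasureTheory Complex Metric Set
open scoped ENNReal
noncomputable def exl (l : ℤ) (t : ℝ) : ℂ := Complex.exp ((l : ℂ) * t * Complex.I)

lemma exl_norm (l : ℤ) (t : ℝ) : ‖exl l t‖ = 1 := by
  have : ((l : ℂ) * t * Complex.I) = (((l : ℝ) * t : ℝ) : ℂ) * Complex.I := by push_cast; ring
  rw [exl, this, Complex.norm_exp_ofReal_mul_I]

lemma exl_cont (l : ℤ) : Continuous (exl l) := by unfold exl; fun_prop

lemma exl_mul (l m : ℤ) (t : ℝ) : exl l t * exl m t = exl (l + m) t := by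
  rw [exl, exl, exl, ← Complex.exp_add]; push_cast; ring_nf

lemma exl_zero (t : ℝ) : exl 0 t = 1 := by simp [exl]

lemma exl_conj (l : ℤ) (t : ℝ) : (starRingEnd ℂ) (exl l t) = exl (-l) t := by
  rw [exl, exl, ← Complex.exp_conj]; simp

lemma exl_integral (l : ℤ) : ∫ t in (0:ℝ)..(2 * Real.pi), exl l t = if l = 0 then (2 * Real.pi : ℂ) else 0 := by
  split_ifs with h
  · subst h; simp [exl_zero]
  · have hc : ((l : ℂ) * Complex.I) ≠ 0 := by simp [h]
    have : ∀ t : ℝ, exl l t = Complex.exp (((l : ℂ) * Complex.I) * t) := by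
      intro t; rw [exl]; ring_nf
    simp_rw [this]
    rw [integral_exp_mul_complex hc]
    have : (l : ℂ) * Complex.I * ((2 * Real.pi : ℝ) : ℂ) = l * (2 * Real.pi * Complex.I) := by push_cast; ring
    rw [this, Complex.exp_int_mul_two_pi_mul_I]; simp

noncomputable def czf (p : ℕ → ℂ) (l : ℤ) : ℂ := if 0 ≤ l then p l.toNat else 0

lemma coef_integral (p : ℕ → ℂ) (hp : Summable fun k => ‖p k‖) (l : ℤ) :
    ∫ t in (0:ℝ)..(2 * Real.pi), (∑' k : ℕ, p k * exl k t) * exl (-l) t = 2 * Real.pi * czf p l := by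
  have h0 : (0:ℝ) ≤ 2 * Real.pi := by positivity
  have h1 : ∀ t, (∑' k : ℕ, p k * exl k t) * exl (-l) t = ∑' k : ℕ, p k * exl (k - l) t := by
    intro t
    rw [← tsum_mul_right]
    congr 1; ext k
    rw [mul_assoc, exl_mul]; rfl
  simp_rw [h1]
  have hitg : ∀ k : ℕ, Integrable (fun t => p k * exl (k - l) t) (volume.restrict (Ioc 0 (2 * Real.pi))) := by
    intro k
    have : Continuous fun t => p k * exl (k - l) t := continuous_const.mul (exl_cont _)
    exact (this.integrableOn_Icc (a := 0) (b := 2 * Real.pi)).mono_set Ioc_subset_Icc_self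
  have hs := hasSum_integral_of_summable_integral_norm hitg (by
    simp only [norm_mul, exl_norm, mul_one]
    simp only [integral_const, smul_eq_mul]
    exact hp.mul_left _)
  rw [intervalIntegral.integral_of_le h0, ← hs.tsum_eq]
  have h2 : ∀ k : ℕ, ∫ t in Ioc 0 (2 * Real.pi), p k * exl (k - l) t = if (k : ℤ) = l then 2 * Real.pi * p k else 0 := by
    intro k
    rw [← intervalIntegral.integral_of_le h0, intervalIntegral.integral_const_mul, exl_integral]
    simp only [sub_eq_zero]
    split_ifs <;> ring
  simp_rw [h2, czf]
  split_ifs with hl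
  · rw [tsum_eq_single l.toNat]
    · simp [hl]
    · intro b hb
      rw [if_neg]; omega
  · rw [mul_zero]
    convert tsum_zero with k
    rw [if_neg]; omega

lemma fejer_key (p : ℕ → ℂ) (hp : Summable fun k => ‖p k‖) (M : ℝ)
    (hM : ∀ t : ℝ, ‖∑' k : ℕ, p k * exl k t‖ ≤ M) (N : ℕ) (m : ℤ) :
    ‖∑ i ∈ Finset.range N, ∑ j ∈ Finset.range N, czf p (m + i - j)‖ ≤ N * M := by
  set F : ℝ → ℂ := fun t => ∑' k : ℕ, p k * exl k t with hF
  have hFc : Continuous F := by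
    refine continuous_tsum (u := fun k => ‖p k‖) (fun k => continuous_const.mul (exl_cont _)) hp ?_
    intro k t; simp [exl_norm]
  set D : ℝ → ℂ := fun t => ∑ j ∈ Finset.range N, exl j t with hD
  have hDc : Continuous D := continuous_finsetSum _ fun j _ => exl_cont _
  have hpi : (0:ℝ) < 2 * Real.pi := by positivity
  have hDD : ∀ t, ((‖D t‖ ^ 2 : ℝ) : ℂ) = ∑ i ∈ Finset.range N, ∑ j ∈ Finset.range N, exl (j - i) t := by
    intro t
    have : ((‖D t‖ ^ 2 : ℝ) : ℂ) = (starRingEnd ℂ) (D t) * D t := by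
      rw [Complex.conj_mul']; push_cast; rfl
    rw [this, hD]
    simp only [map_sum, exl_conj, Finset.sum_mul_sum, exl_mul]
    refine Finset.sum_congr rfl fun i _ => Finset.sum_congr rfl fun j _ => ?_
    congr 1; ring
  have hDint : ∫ t in (0:ℝ)..(2 * Real.pi), ‖D t‖ ^ 2 = 2 * Real.pi * N := by
    have : ((∫ t in (0:ℝ)..(2 * Real.pi), ‖D t‖ ^ 2 : ℝ) : ℂ) = ((2 * Real.pi * N : ℝ) : ℂ) := by
      rw [← intervalIntegral.integral_ofReal]
      simp_rw [hDD]
      rw [intervalIntegral.integral_finsetSum]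
      · have : ∀ i ∈ Finset.range N, (∫ t in (0:ℝ)..(2 * Real.pi), ∑ j ∈ Finset.range N, exl (j - i) t) = 2 * Real.pi := by
          intro i hi
          rw [intervalIntegral.integral_finsetSum (fun j _ => (exl_cont _).intervalIntegrable _ _)]
          simp_rw [exl_integral]
          rw [Finset.sum_eq_single i]
          · simp
          · intro b _ hb; rw [if_neg]; omega
          · intro h; exact absurd hi h
        rw [Finset.sum_congr rfl this]
        simp; ring
      · intro i _
        exact (continuous_finsetSum _ fun j _ => exl_cont _).intervalIntegrable _ _
    exact_mod_cast this
  have hmain : ∫ t in (0:ℝ)..(2 * Real.pi), F t * exl (-m) t * ((‖D t‖ ^ 2 : ℝ) : ℂ)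
      = 2 * Real.pi * ∑ i ∈ Finset.range N, ∑ j ∈ Finset.range N, czf p (m + i - j) := by
    have : ∀ t, F t * exl (-m) t * ((‖D t‖ ^ 2 : ℝ) : ℂ) =
        ∑ i ∈ Finset.range N, ∑ j ∈ Finset.range N, F t * exl (-(m + i - j)) t := by
      intro t
      rw [hDD, Finset.mul_sum]
      refine Finset.sum_congr rfl fun i _ => ?_
      rw [Finset.mul_sum]
      refine Finset.sum_congr rfl fun j _ => ?_
      rw [mul_assoc, exl_mul]; congr 2; ring
    simp_rw [this]
    rw [intervalIntegral.integral_finsetSum, Finset.mul_sum]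
    · refine Finset.sum_congr rfl fun i _ => ?_
      rw [intervalIntegral.integral_finsetSum, Finset.mul_sum]
      · refine Finset.sum_congr rfl fun j _ => ?_
        exact coef_integral p hp _
      · intro j _
        exact (hFc.mul (exl_cont _)).intervalIntegrable _ _
    · intro i _
      exact (continuous_finsetSum _ fun j _ => hFc.mul (exl_cont _)).intervalIntegrable _ _
  have hle : ‖∫ t in (0:ℝ)..(2 * Real.pi), F t * exl (-m) t * ((‖D t‖ ^ 2 : ℝ) : ℂ)‖ ≤ 2 * Real.pi * N * M := by
    calc _ ≤ ∫ t in (0:ℝ)..(2 * Real.pi), M * ‖D t‖ ^ 2 := by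
          apply intervalIntegral.norm_integral_le_of_norm_le hpi.le
          · refine Filter.Eventually.of_forall fun t _ => ?_
            rw [norm_mul, norm_mul, exl_norm, mul_one, Complex.norm_real, Real.norm_of_nonneg (by positivity)]
            exact mul_le_mul_of_nonneg_right (hM t) (by positivity)
          · exact (continuous_const.mul (hDc.norm.pow 2)).intervalIntegrable _ _
      _ = _ := by rw [intervalIntegral.integral_const_mul, hDint]; ring
  rw [hmain, norm_mul] at hle
  have : ‖(2 * Real.pi : ℂ)‖ = 2 * Real.pi := by
    rw [show (2 * Real.pi : ℂ) = ((2 * Real.pi : ℝ) : ℂ) by push_cast; rfl, Complex.norm_real, Real.norm_of_nonneg hpi.le]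
  rw [this, mul_assoc (2 * Real.pi) (N : ℝ) M] at hle
  exact le_of_mul_le_mul_left hle hpi

section seqs
open Filter Topology
lemma seq_tendsto_zero (α : ℕ → ℝ) (hpos : ∀ n, 0 < α n) (hdec : ∀ n, α (n + 1) ≤ α n)
    (hsum : Summable fun n => α n / ((n : ℝ) + 1)) : Tendsto α atTop (𝓝 0) := by
  have ha : Antitone α := antitone_nat_of_succ_le hdec
  have hb : BddBelow (Set.range α) := ⟨0, by rintro _ ⟨n, rfl⟩; exact (hpos n).le⟩
  have ht := tendsto_atTop_ciInf ha hb
  set L := ⨅ n, α n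
  have hL : ∀ n, L ≤ α n := fun n => ciInf_le hb n
  have hL0 : 0 ≤ L := le_ciInf fun n => (hpos n).le
  rcases hL0.eq_or_lt with h | h
  · rw [← h] at ht; exact ht
  · exfalso
    have h1 : Summable fun n : ℕ => L / ((n : ℝ) + 1) :=
      hsum.of_nonneg_of_le (fun n => by positivity) (fun n => by gcongr; exact hL n)
    have h2 : Summable fun n : ℕ => 1 / ((n : ℝ) + 1) := by
      refine (h1.mul_left L⁻¹).congr fun n => ?_
      field_simp
    have h3 : Summable fun n : ℕ => 1 / (n : ℝ) := by
      rw [← summable_nat_add_iff 1]; simpa using h2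
    exact Real.not_summable_one_div_natCast h3

lemma seq_partial1 (α : ℕ → ℝ) (N : ℕ) :
    ∑ n ∈ Finset.range N, ((n : ℝ) + 1) * (α n - 2 * α (n + 1) + α (n + 2))
      = α 0 - α N - N * (α N - α (N + 1)) := by
  induction N with
  | zero => simp
  | succ N ih => rw [Finset.sum_range_succ, ih]; push_cast; ring

lemma seq_partial2 (α : ℕ → ℝ) (hpos : ∀ n, 0 < α n) (N : ℕ) :
    ∑ n ∈ Finset.range (N + 1), ((n : ℝ) + 1) * (harmonic (n + 1) : ℝ) * (α n - 2 * α (n + 1) + α (n + 2))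
      + (N + 1) * (harmonic (N + 1) : ℝ) * (α (N + 1) - α (N + 2)) + ((harmonic N : ℝ) + 1) * α (N + 1)
      ≤ 2 * ∑ n ∈ Finset.range (N + 1), α n / ((n : ℝ) + 1) := by
  induction N with
  | zero => simp [harmonic_succ]; linarith [hpos 0]
  | succ N ih =>
    rw [Finset.sum_range_succ, Finset.sum_range_succ _ (N + 1), mul_add (2 : ℝ)]
    have hp := hpos (N + 1)
    have key : (1 / ((N : ℝ) + 1)) * α (N + 1) ≤ 2 * (α (N + 1) / ((N + 1 : ℕ) + 1 : ℝ)) := by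
      push_cast
      rw [one_div_mul_eq_div, ← mul_div_assoc, div_le_div_iff₀ (by positivity) (by positivity)]
      have : (0:ℝ) ≤ N := by positivity
      nlinarith
    refine le_trans (le_of_eq ?_) (add_le_add ih key)
    rw [harmonic_succ (N + 1), harmonic_succ N]
    push_cast
    field_simp
    ring


lemma seq_bound1 (α : ℕ → ℝ) (hpos : ∀ n, 0 < α n) (hdec : ∀ n, α (n + 1) ≤ α n) (N : ℕ) :
    ∑ n ∈ Finset.range N, ((n : ℝ) + 1) * (α n - 2 * α (n + 1) + α (n + 2)) ≤ α 0 := by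
  rw [seq_partial1]
  have := mul_nonneg (Nat.cast_nonneg (α := ℝ) N) (sub_nonneg.2 (hdec N))
  linarith [hpos N]

lemma seq_summable1 (α : ℕ → ℝ) (hpos : ∀ n, 0 < α n) (hdec : ∀ n, α (n + 1) ≤ α n)
    (hconc : ∀ n, 0 ≤ α n - 2 * α (n + 1) + α (n + 2)) :
    Summable fun n : ℕ => ((n : ℝ) + 1) * (α n - 2 * α (n + 1) + α (n + 2)) :=
  summable_of_sum_range_le (fun n => mul_nonneg (by positivity) (hconc n)) (seq_bound1 α hpos hdec)

lemma seq_bound2 (α : ℕ → ℝ) (hpos : ∀ n, 0 < α n) (hdec : ∀ n, α (n + 1) ≤ α n)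
    (hconc : ∀ n, 0 ≤ α n - 2 * α (n + 1) + α (n + 2))
    (hsum : Summable fun n => α n / ((n : ℝ) + 1)) (N : ℕ) :
    ∑ n ∈ Finset.range N, ((n : ℝ) + 1) * (harmonic (n + 1) : ℝ) * (α n - 2 * α (n + 1) + α (n + 2))
      ≤ 2 * ∑' n, α n / ((n : ℝ) + 1) := by
  have hh : ∀ n, (0:ℝ) ≤ harmonic n := fun n => by
    rw [harmonic]; push_cast; positivity
  have h1 := seq_partial2 α hpos N
  have h2 : ∑ n ∈ Finset.range (N + 1), α n / ((n : ℝ) + 1) ≤ ∑' n, α n / ((n : ℝ) + 1) :=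
    hsum.sum_le_tsum _ fun n _ => div_nonneg (hpos n).le (by positivity)
  rw [Finset.sum_range_succ] at h1
  have h3 : 0 ≤ ((N : ℝ) + 1) * (harmonic (N + 1) : ℝ) * (α N - 2 * α (N + 1) + α (N + 2)) :=
    mul_nonneg (mul_nonneg (by positivity) (hh _)) (hconc _)
  have h4 : 0 ≤ ((N : ℝ) + 1) * (harmonic (N + 1) : ℝ) * (α (N + 1) - α (N + 2)) :=
    mul_nonneg (mul_nonneg (by positivity) (hh _)) (sub_nonneg.2 (hdec _))
  have h5 : 0 ≤ ((harmonic N : ℝ) + 1) * α (N + 1) := mul_nonneg (by linarith [hh N]) (hpos _).le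
  linarith

lemma seq_tendsto_mul (α : ℕ → ℝ) (hpos : ∀ n, 0 < α n) (hdec : ∀ n, α (n + 1) ≤ α n)
    (hconc : ∀ n, 0 ≤ α n - 2 * α (n + 1) + α (n + 2))
    (h0 : Tendsto α atTop (𝓝 0)) :
    Tendsto (fun N : ℕ => (N : ℝ) * (α N - α (N + 1))) atTop (𝓝 0) := by
  have hs := seq_summable1 α hpos hdec hconc
  set E : ℕ → ℝ := fun N => ∑ n ∈ Finset.range N, ((n : ℝ) + 1) * (α n - 2 * α (n + 1) + α (n + 2)) with hE
  have hEt := hs.hasSum.tendsto_sum_nat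
  set S := ∑' n : ℕ, ((n : ℝ) + 1) * (α n - 2 * α (n + 1) + α (n + 2))
  have hES : ∀ N, E N ≤ S := fun N => hs.sum_le_tsum _ fun n _ => mul_nonneg (by positivity) (hconc n)
  have hd : Tendsto (fun M => α M - α (M + 1)) atTop (𝓝 0) := by
    simpa using h0.sub (h0.comp (tendsto_add_atTop_nat 1))
  have key : ∀ N k : ℕ, (N : ℝ) * ((α N - α (N + 1)) - (α (N + k) - α (N + k + 1))) ≤ E (N + k) - E N := by
    intro N k
    induction k with
    | zero => simp
    | succ k ih =>
      have : E (N + (k + 1)) = E (N + k) + (((N + k : ℕ) : ℝ) + 1) * (α (N + k) - 2 * α (N + k + 1) + α (N + k + 2)) := by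
        rw [hE]; simp only; rw [← add_assoc, Finset.sum_range_succ]
      rw [this]
      have h1 : 0 ≤ ((k : ℝ) + 1) * (α (N + k) - 2 * α (N + k + 1) + α (N + k + 2)) :=
        mul_nonneg (by positivity) (hconc _)
      push_cast
      rw [show N + (k + 1) = N + k + 1 by ring]
      rw [show N + k + 1 + 1 = N + k + 2 by ring] at *
      nlinarith
  have key2 : ∀ N : ℕ, (N : ℝ) * (α N - α (N + 1)) ≤ S - E N := by
    intro N
    have ht : Tendsto (fun k : ℕ => (N : ℝ) * ((α N - α (N + 1)) - (α (N + k) - α (N + k + 1)))) atTop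
        (𝓝 ((N : ℝ) * ((α N - α (N + 1)) - 0))) := by
      refine (tendsto_const_nhds.sub ?_).const_mul _
      exact hd.comp (tendsto_atTop_mono (fun k => Nat.le_add_left k N) tendsto_id)
    rw [sub_zero] at ht
    exact le_of_tendsto' ht fun k => (key N k).trans (sub_le_sub_right (hES _) _)
  refine squeeze_zero (fun N => mul_nonneg (by positivity) (sub_nonneg.2 (hdec N))) key2 ?_
  simpa using (tendsto_const_nhds (x := S)).sub hEt

end seqs

noncomputable def TT (a : ℕ → ℂ) (N : ℕ) (z : ℂ) : ℂ :=
  ∑ i ∈ Finset.range N, ∑ k ∈ Finset.range (i + 1), a k * z ^ k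

lemma TT_cont (a : ℕ → ℂ) (N : ℕ) : Continuous (TT a N) := by unfold TT; fun_prop

lemma TT_diff (a : ℕ → ℂ) (N : ℕ) : Differentiable ℂ (TT a N) := by unfold TT; fun_prop

lemma TT_poly (a : ℕ → ℂ) (N : ℕ) (z : ℂ) :
    TT a N z = ∑ k ∈ Finset.range N, (((N : ℂ) - k) * a k) * z ^ k := by
  induction N with
  | zero => simp [TT]
  | succ N ih =>
    have : TT a (N + 1) z = TT a N z + ∑ k ∈ Finset.range (N + 1), a k * z ^ k := by
      simp [TT, Finset.sum_range_succ]
    rw [this, ih, Finset.sum_range_succ, Finset.sum_range_succ, ← add_assoc, ← Finset.sum_add_distrib]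
    push_cast
    congr 1
    · refine Finset.sum_congr rfl fun k _ => ?_
      ring
    · ring

lemma exl_nat (z : ℂ) (k : ℕ) (t : ℝ) (a : ℂ) : a * z ^ k * exl k t = a * (z * exl 1 t) ^ k := by
  have : exl k t = exl 1 t ^ k := by
    rw [exl, exl, ← Complex.exp_nat_mul]; push_cast; ring_nf
  rw [this]; ring

lemma TT_bound (a : ℕ → ℂ) (f : ℂ → ℂ) (M : ℝ)
    (hs : ∀ z ∈ ball (0 : ℂ) 1, HasSum (fun k => a k * z ^ k) (f z))
    (hM : ∀ z ∈ ball (0 : ℂ) 1, ‖f z‖ ≤ M) (N : ℕ) (z : ℂ) (hz : z ∈ ball (0 : ℂ) 1) :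
    ‖TT a N z‖ ≤ N * M := by
  have hp : Summable fun k => ‖a k * z ^ k‖ := (hs z hz).summable.norm
  have hb : ∀ t : ℝ, ‖∑' k : ℕ, a k * z ^ k * exl k t‖ ≤ M := by
    intro t
    have hz' : z * exl 1 t ∈ ball (0 : ℂ) 1 := by
      simpa [exl_norm] using hz
    simp_rw [exl_nat]
    rw [(hs _ hz').tsum_eq]
    exact hM _ hz'
  have := fejer_key (fun k => a k * z ^ k) hp M hb N 0
  convert this using 2
  rw [TT]
  refine Finset.sum_congr rfl fun i hi => ?_
  have hi' : i + 1 ≤ N := by simpa using hi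
  rw [← Finset.sum_subset (Finset.range_mono hi'), ← Finset.sum_range_reflect]
  · refine Finset.sum_congr rfl fun j hj => ?_
    have hj' : j < i + 1 := by simpa using hj
    rw [czf, if_pos (by omega)]
    have : (0 + (i : ℤ) - j).toNat = i + 1 - 1 - j := by omega
    simp only [this]
  · intro j _ hj
    have hj' : ¬ j < i + 1 := by simpa using hj
    rw [czf, if_neg (by omega)]

lemma TT_bound_closed (a : ℕ → ℂ) (f : ℂ → ℂ) (M : ℝ)
    (hs : ∀ z ∈ ball (0 : ℂ) 1, HasSum (fun k => a k * z ^ k) (f z))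
    (hM : ∀ z ∈ ball (0 : ℂ) 1, ‖f z‖ ≤ M) (N : ℕ) (z : ℂ) (hz : z ∈ closedBall (0 : ℂ) 1) :
    ‖TT a N z‖ ≤ N * M := by
  rw [← closure_ball (0 : ℂ) one_ne_zero] at hz
  have hc : IsClosed {z : ℂ | ‖TT a N z‖ ≤ N * M} :=
    isClosed_le (TT_cont a N).norm continuous_const
  exact closure_minimal (fun w hw => TT_bound a f M hs hM N w hw) hc hz

lemma bernstein_poly (q : ℕ → ℂ) (n : ℕ) (B : ℝ)
    (hB : ∀ z : ℂ, ‖z‖ = 1 → ‖∑ k ∈ Finset.range (n + 1), q k * z ^ k‖ ≤ B) (z : ℂ) (hz : ‖z‖ = 1) :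
    ‖∑ k ∈ Finset.range (n + 1), (k : ℂ) * (q k * z ^ k)‖ ≤ n * B := by
  set p : ℕ → ℂ := fun k => if k < n + 1 then q k * z ^ k else 0 with hpdef
  have hp0 : ∀ k ∉ Finset.range (n + 1), p k = 0 := by
    intro k hk
    rw [hpdef]; simp only; rw [if_neg (by simpa using hk)]
  have hp1 : ∀ k ∈ Finset.range (n + 1), p k = q k * z ^ k := by
    intro k hk
    rw [hpdef]; simp only; rw [if_pos (by simpa using hk)]
  clear_value p
  have hp : Summable fun k => ‖p k‖ :=
    summable_of_ne_finset_zero (s := Finset.range (n + 1)) fun k hk => by rw [hp0 k hk, norm_zero]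
  have hb : ∀ t : ℝ, ‖∑' k : ℕ, p k * exl k t‖ ≤ B := by
    intro t
    rw [tsum_eq_sum (s := Finset.range (n + 1)) (fun k hk => by rw [hp0 k hk, zero_mul])]
    rw [Finset.sum_congr rfl (fun k hk => by rw [hp1 k hk, exl_nat])]
    exact hB _ (by rw [norm_mul, hz, exl_norm, mul_one])
  have := fejer_key p hp B hb n n
  convert this using 2
  have h1 : ∀ i ∈ Finset.range n, ∑ j ∈ Finset.range n, czf p ((n : ℤ) + i - j)
      = ∑ k ∈ Finset.range (n + 1), if i < k then p k else 0 := by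
    intro i hi
    have hi' : i < n := by simpa using hi
    rw [← Finset.sum_range_reflect]
    have e1 : ∀ j ∈ Finset.range n, czf p ((n : ℤ) + i - ((n - 1 - j : ℕ) : ℤ)) = p (i + 1 + j) := by
      intro j hj
      have hj' : j < n := by simpa using hj
      rw [czf, if_pos (by omega)]
      congr 1; omega
    rw [Finset.sum_congr rfl e1, ← Finset.sum_filter]
    have e2 := Finset.sum_Ico_eq_sum_range p (i + 1) (i + 1 + n)
    rw [show i + 1 + n - (i + 1) = n by omega] at e2
    rw [← e2]
    symm
    apply Finset.sum_subset
    · intro k hk; simp at hk ⊢; omega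
    · intro k hk hk2
      apply hp0
      simp at hk hk2 ⊢; omega
  rw [Finset.sum_congr rfl h1, Finset.sum_comm]
  refine Finset.sum_congr rfl fun k hk => ?_
  rw [← Finset.sum_filter, Finset.sum_const, hp1 k hk, nsmul_eq_mul]
  congr 2
  have : (Finset.range n).filter (fun i => i < k) = Finset.range k := by
    ext i; simp at hk ⊢; omega
  rw [this, Finset.card_range]

lemma TT_lip (a : ℕ → ℂ) (f : ℂ → ℂ) (M : ℝ)
    (hs : ∀ z ∈ ball (0 : ℂ) 1, HasSum (fun k => a k * z ^ k) (f z))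
    (hM : ∀ z ∈ ball (0 : ℂ) 1, ‖f z‖ ≤ M) (N : ℕ) (s t : ℝ) :
    ‖TT a N (Complex.exp (t * I)) - TT a N (Complex.exp (s * I))‖ ≤ N * (N * M) * |t - s| := by
  have hM0 : 0 ≤ M := (norm_nonneg _).trans (hM 0 (by simp))
  rcases N with _ | n
  · simp [TT]
  set q : ℕ → ℂ := fun k => (((n + 1 : ℕ) : ℂ) - k) * a k with hq
  have hT : ∀ z, TT a (n + 1) z = ∑ k ∈ Finset.range (n + 1), q k * z ^ k := fun z => TT_poly a (n + 1) z
  have hB : ∀ z : ℂ, ‖z‖ = 1 → ‖∑ k ∈ Finset.range (n + 1), q k * z ^ k‖ ≤ (n + 1 : ℕ) * M := by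
    intro z hz
    rw [← hT]
    exact TT_bound_closed a f M hs hM _ z (by simp [hz])
  have hder : ∀ x : ℝ, HasDerivAt (fun x : ℝ => TT a (n + 1) (Complex.exp (x * I)))
      (I * ∑ k ∈ Finset.range (n + 1), (k : ℂ) * (q k * (Complex.exp (x * I)) ^ k)) x := by
    intro x
    have h1 : HasDerivAt (fun x : ℝ => Complex.exp (x * I)) (Complex.exp (x * I) * I) x := by
      have := (((hasDerivAt_id (x : ℂ)).mul_const I).cexp).comp_ofReal
      simpa using this
    simp_rw [hT]
    rw [Finset.mul_sum]
    refine HasDerivAt.fun_sum fun k _ => ?_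
    refine ((h1.fun_pow k).const_mul (q k)).congr_deriv ?_
    rcases k with _ | k
    · simp
    · simp only [Nat.add_sub_cancel]; ring
  have hbd : ∀ x : ℝ, ‖I * ∑ k ∈ Finset.range (n + 1), (k : ℂ) * (q k * (Complex.exp (x * I)) ^ k)‖
      ≤ ((n + 1 : ℕ) : ℝ) * ((n + 1 : ℕ) * M) := by
    intro x
    rw [norm_mul, norm_I, one_mul]
    refine (bernstein_poly q n _ hB _ (Complex.norm_exp_ofReal_mul_I x)).trans ?_
    gcongr
    omega
  have := Convex.norm_image_sub_le_of_norm_hasDerivWithin_le (s := Set.univ)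
    (fun x _ => (hder x).hasDerivWithinAt) (fun x _ => hbd x) convex_univ (mem_univ s) (mem_univ t)
  simpa [Real.norm_eq_abs] using this

section idn
open Filter Topology
lemma abel_partial (α : ℕ → ℝ) (a : ℕ → ℂ) (z : ℂ) (N : ℕ) :
    ∑ n ∈ Finset.range N, a n * (α n : ℂ) * z ^ n =
      ∑ n ∈ Finset.range N, ((α n - 2 * α (n + 1) + α (n + 2) : ℝ) : ℂ) * TT a (n + 1) z
      + ((α N - α (N + 1) : ℝ) : ℂ) * TT a N z + (α N : ℂ) * ∑ k ∈ Finset.range N, a k * z ^ k := by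
  induction N with
  | zero => simp [TT]
  | succ N ih =>
    have h : TT a (N + 1) z = TT a N z + ∑ k ∈ Finset.range (N + 1), a k * z ^ k := by
      simp [TT, Finset.sum_range_succ]
    rw [Finset.sum_range_succ, ih, Finset.sum_range_succ, h, Finset.sum_range_succ]
    push_cast
    ring

lemma conv_eq (α : ℕ → ℝ) (hpos : ∀ n, 0 < α n) (hdec : ∀ n, α (n + 1) ≤ α n)
    (hconc : ∀ n, 0 ≤ α n - 2 * α (n + 1) + α (n + 2))
    (h0 : Tendsto α atTop (𝓝 0)) (a : ℕ → ℂ) (f : ℂ → ℂ) (M : ℝ)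
    (hs : ∀ z ∈ ball (0 : ℂ) 1, HasSum (fun k => a k * z ^ k) (f z))
    (hM : ∀ z ∈ ball (0 : ℂ) 1, ‖f z‖ ≤ M) (z : ℂ) (hz : z ∈ ball (0 : ℂ) 1)
    (hsm : Summable fun n : ℕ => ((α n - 2 * α (n + 1) + α (n + 2) : ℝ) : ℂ) * TT a (n + 1) z) :
    ∑' n : ℕ, a n * (α n : ℂ) * z ^ n =
      ∑' n : ℕ, ((α n - 2 * α (n + 1) + α (n + 2) : ℝ) : ℂ) * TT a (n + 1) z := by
  have ha : Antitone α := antitone_nat_of_succ_le hdec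
  have hp : Summable fun n => ‖a n * z ^ n‖ := (hs z hz).summable.norm
  have hL : Summable fun n : ℕ => a n * (α n : ℂ) * z ^ n := by
    refine Summable.of_norm_bounded (hp.mul_left (α 0)) fun n => ?_
    rw [show a n * (α n : ℂ) * z ^ n = (α n : ℂ) * (a n * z ^ n) by ring, norm_mul, Complex.norm_real,
      Real.norm_of_nonneg (hpos n).le]
    gcongr
    exact ha (Nat.zero_le n)
  have t1 := hL.hasSum.tendsto_sum_nat
  have t2 := hsm.hasSum.tendsto_sum_nat
  have t3 : Tendsto (fun N => ((α N - α (N + 1) : ℝ) : ℂ) * TT a N z) atTop (𝓝 0) := by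
    have h1 := (seq_tendsto_mul α hpos hdec hconc h0).mul_const M
    rw [zero_mul] at h1
    refine squeeze_zero_norm (fun N => ?_) h1
    rw [norm_mul, Complex.norm_real, Real.norm_of_nonneg (sub_nonneg.2 (hdec N))]
    calc _ ≤ (α N - α (N + 1)) * (N * M) :=
          mul_le_mul_of_nonneg_left (TT_bound a f M hs hM N z hz) (sub_nonneg.2 (hdec N))
      _ = _ := by ring
  have t4 : Tendsto (fun N => (α N : ℂ) * ∑ k ∈ Finset.range N, a k * z ^ k) atTop (𝓝 0) := by
    have h1 : Tendsto (fun N => (α N : ℂ)) atTop (𝓝 0) := by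
      simpa [Function.comp_def] using (Complex.continuous_ofReal.tendsto 0).comp h0
    simpa using h1.mul (hs z hz).tendsto_sum_nat
  have t5 := (t2.add t3).add t4
  simp only [add_zero] at t5
  refine tendsto_nhds_unique t1 (t5.congr fun N => ?_)
  rw [abel_partial]
end idn

lemma circ_lintegral (F : ℂ → ℝ≥0∞) (hF : Measurable F) (s : ℝ) :
    ∫⁻ ζ, F ζ ∂circleMeasure =
      (ENNReal.ofReal (2 * Real.pi))⁻¹ *
        ∫⁻ θ in Ioc (s - Real.pi) (s + Real.pi), F (Complex.exp (θ * I)) := by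
  have hm : Measurable fun θ : ℝ => Complex.exp (θ * I) := by fun_prop
  rw [circleMeasure, lintegral_map hF hm, lintegral_smul_measure, smul_eq_mul]
  congr 1
  have hpi : (0:ℝ) < 2 * Real.pi := by positivity
  have h1 := isAddFundamentalDomain_Ioc hpi 0
  have h2 := isAddFundamentalDomain_Ioc hpi (s - Real.pi)
  rw [zero_add] at h1
  rw [show s - Real.pi + 2 * Real.pi = s + Real.pi by ring] at h2
  refine h1.setLIntegral_eq h2 (fun θ : ℝ => F (Complex.exp (θ * I))) ?_
  rintro ⟨g, hg⟩ x
  obtain ⟨k, rfl⟩ := AddSubgroup.mem_zmultiples_iff.1 hg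
  simp only [AddSubgroup.mk_vadd, vadd_eq_add]
  congr 1
  have : (((k • (2 * Real.pi) + x : ℝ)) : ℂ) * I = x * I + k * (2 * Real.pi * I) := by
    push_cast [zsmul_eq_mul]; ring
  rw [this, Complex.exp_add, Complex.exp_int_mul_two_pi_mul_I, mul_one]

lemma chord_lower (s θ : ℝ) (h : |θ - s| ≤ Real.pi) :
    2 / Real.pi * |θ - s| ≤ ‖Complex.exp (θ * I) - Complex.exp (s * I)‖ := by
  have h1 : Complex.exp (θ * I) - Complex.exp (s * I)
      = Complex.exp (s * I) * (Complex.exp (I * ((θ - s : ℝ) : ℂ)) - 1) := by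
    rw [mul_sub, ← Complex.exp_add, mul_one]; push_cast; ring_nf
  rw [h1, norm_mul, Complex.norm_exp_ofReal_mul_I, one_mul, Complex.norm_exp_I_mul_ofReal_sub_one,
    Real.norm_eq_abs, abs_mul, abs_two]
  have h2 : |Real.sin ((θ - s) / 2)| = Real.sin (|θ - s| / 2) := by
    rcases abs_cases (θ - s) with ⟨e, h0⟩ | ⟨e, h0⟩
    · rw [e, abs_of_nonneg]
      apply Real.sin_nonneg_of_nonneg_of_le_pi <;> linarith [Real.pi_pos]
    · rw [e, neg_div, Real.sin_neg, abs_of_nonpos]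
      apply Real.sin_nonpos_of_nonpos_of_neg_pi_le <;> linarith [Real.pi_pos]
  rw [h2]
  have := Real.mul_le_sin (x := |θ - s| / 2) (by positivity) (by linarith)
  linarith

lemma kernel_integral (c : ℝ) (hc : 0 < c) (s : ℝ) :
    ∫⁻ θ in Ioc (s - Real.pi) (s + Real.pi), ENNReal.ofReal (1 / (c + |θ - s|))
      = ENNReal.ofReal (2 * Real.log ((c + Real.pi) / c)) := by
  have hpi := Real.pi_pos
  have hcont : Continuous fun x : ℝ => 1 / (c + |x|) := by
    refine continuous_const.div (by fun_prop) fun x => ?_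
    positivity
  have hcont2 : Continuous fun θ : ℝ => 1 / (c + |θ - s|) := hcont.comp (continuous_id.sub continuous_const)
  rw [← ofReal_integral_eq_lintegral_ofReal]
  · rw [← intervalIntegral.integral_of_le (by linarith),
      intervalIntegral.integral_comp_sub_right (fun x => 1 / (c + |x|))]
    rw [show s - Real.pi - s = -Real.pi by ring, show s + Real.pi - s = Real.pi by ring]
    rw [← intervalIntegral.integral_add_adjacent_intervals (b := 0)
      (hcont.intervalIntegrable _ _) (hcont.intervalIntegrable _ _)]
    have e1 : ∫ x in (0:ℝ)..Real.pi, 1 / (c + |x|) = Real.log ((c + Real.pi) / c) := by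
      have : ∫ x in (0:ℝ)..Real.pi, 1 / (c + |x|) = ∫ x in (0:ℝ)..Real.pi, 1 / (c + x) := by
        refine intervalIntegral.integral_congr fun x hx => ?_
        rw [uIcc_of_le hpi.le] at hx
        simp only [abs_of_nonneg hx.1]
      rw [this, intervalIntegral.integral_comp_add_left (fun x => 1 / x), add_zero,
        integral_one_div_of_pos hc (by positivity)]
    have e2 : ∫ x in (-Real.pi)..0, 1 / (c + |x|) = Real.log ((c + Real.pi) / c) := by
      have := intervalIntegral.integral_comp_neg (a := 0) (b := Real.pi) (fun x => 1 / (c + |x|))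
      simp only [abs_neg, neg_zero] at this
      rw [← this, e1]
    rw [e1, e2]; ring_nf
  · exact (hcont2.integrableOn_Icc).mono_set Ioc_subset_Icc_self
  · exact Filter.Eventually.of_forall fun θ => by positivity

lemma log_harm (N : ℕ) (hN : 1 ≤ N) :
    Real.log ((2 / (N : ℝ) + Real.pi) / (2 / N)) ≤ 2 * (harmonic N : ℝ) := by
  have hN' : (1:ℝ) ≤ N := by exact_mod_cast hN
  have h1 : (2 / (N : ℝ) + Real.pi) / (2 / N) = 1 + Real.pi * N / 2 := by
    field_simp
  have h2 := log_add_one_le_harmonic N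
  have h3 : Real.log (((N + 1 : ℕ) : ℝ) ^ 2) = 2 * Real.log ((N + 1 : ℕ) : ℝ) := by
    rw [Real.log_pow]; norm_num
  calc _ ≤ Real.log (((N + 1 : ℕ) : ℝ) ^ 2) := by
        rw [h1]
        apply Real.log_le_log (by positivity)
        push_cast
        nlinarith [Real.pi_le_four]
    _ ≤ _ := by rw [h3]; linarith

lemma TT_lam (a : ℕ → ℂ) (f : ℂ → ℂ) (M : ℝ)
    (hs : ∀ z ∈ ball (0 : ℂ) 1, HasSum (fun k => a k * z ^ k) (f z))
    (hM : ∀ z ∈ ball (0 : ℂ) 1, ‖f z‖ ≤ M) (N : ℕ) (hN : 1 ≤ N) (s : ℝ) :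
    ∫⁻ ζ, ENNReal.ofReal (‖TT a N ζ - TT a N (Complex.exp (s * I))‖ / ‖ζ - Complex.exp (s * I)‖)
        ∂circleMeasure ≤ ENNReal.ofReal (4 * (N * M * (harmonic N : ℝ))) := by
  have hM0 : 0 ≤ M := (norm_nonneg _).trans (hM 0 (by simp))
  have hpi := Real.pi_pos
  have hNpos : (0:ℝ) < N := by exact_mod_cast hN
  have hmeas : Measurable fun ζ => ENNReal.ofReal
      (‖TT a N ζ - TT a N (Complex.exp (s * I))‖ / ‖ζ - Complex.exp (s * I)‖) := by
    have := (TT_cont a N).measurable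
    fun_prop
  rw [circ_lintegral _ hmeas s]
  have hpt : ∀ θ ∈ Ioc (s - Real.pi) (s + Real.pi),
      ENNReal.ofReal (‖TT a N (Complex.exp (θ * I)) - TT a N (Complex.exp (s * I))‖
        / ‖Complex.exp (θ * I) - Complex.exp (s * I)‖)
      ≤ ENNReal.ofReal (2 * Real.pi * (N * M)) * ENNReal.ofReal (1 / (2 / N + |θ - s|)) := by
    intro θ hθ
    rw [← ENNReal.ofReal_mul (by positivity)]
    apply ENNReal.ofReal_le_ofReal
    have hτ : |θ - s| ≤ Real.pi := by
      rw [abs_le]; constructor <;> linarith [hθ.1, hθ.2]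
    have hch := chord_lower s θ hτ
    have hl := TT_lip a f M hs hM N s θ
    have hb : ‖TT a N (Complex.exp (θ * I)) - TT a N (Complex.exp (s * I))‖ ≤ 2 * (N * M) := by
      refine (norm_sub_le _ _).trans ?_
      have h1 := TT_bound_closed a f M hs hM N (Complex.exp (θ * I)) (by simp [Complex.norm_exp_ofReal_mul_I])
      have h2 := TT_bound_closed a f M hs hM N (Complex.exp (s * I)) (by simp [Complex.norm_exp_ofReal_mul_I])
      linarith
    set τ := |θ - s| with hτdef
    set W := ‖TT a N (Complex.exp (θ * I)) - TT a N (Complex.exp (s * I))‖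
    have hW : 0 ≤ W := norm_nonneg _
    rcases (abs_nonneg (θ - s)).eq_or_lt with h0 | h0
    · have : θ = s := by
        have := abs_eq_zero.1 h0.symm; linarith
      have : ‖Complex.exp (θ * I) - Complex.exp (s * I)‖ = 0 := by rw [this]; simp
      rw [this, div_zero]; positivity
    · rw [← hτdef] at h0
      calc W / ‖Complex.exp (θ * I) - Complex.exp (s * I)‖ ≤ W / (2 / Real.pi * τ) := by
            gcongr
        _ ≤ _ := by
            rw [mul_one_div, div_le_div_iff₀ (by positivity) (by positivity)]
            have e1 : W * (2 / N) ≤ 2 * (N * M) * τ := by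
              calc W * (2 / N) ≤ (N * (N * M) * τ) * (2 / N) := by gcongr
                _ = _ := by field_simp
            have e2 : W * τ ≤ 2 * (N * M) * τ := by gcongr
            have e3 : 2 * Real.pi * (N * M) * (2 / Real.pi * τ) = 4 * (N * M) * τ := by
              field_simp; ring
            rw [e3]; linarith
  calc _ ≤ (ENNReal.ofReal (2 * Real.pi))⁻¹ * ∫⁻ θ in Ioc (s - Real.pi) (s + Real.pi),
        ENNReal.ofReal (2 * Real.pi * (N * M)) * ENNReal.ofReal (1 / (2 / N + |θ - s|)) := by
        gcongr 1
        exact setLIntegral_mono' measurableSet_Ioc hpt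
    _ = ENNReal.ofReal ((2 * Real.pi)⁻¹ * (2 * Real.pi * (N * M) * (2 * Real.log ((2 / N + Real.pi) / (2 / N))))) := by
        rw [lintegral_const_mul' _ _ ENNReal.ofReal_ne_top, kernel_integral _ (by positivity),
          ← ENNReal.ofReal_mul (by positivity), ← ENNReal.ofReal_inv_of_pos (by positivity),
          ← ENNReal.ofReal_mul (by positivity)]
    _ ≤ _ := by
        apply ENNReal.ofReal_le_ofReal
        have := log_harm N hN
        have e : (2 * Real.pi)⁻¹ * (2 * Real.pi * (N * M) * (2 * Real.log ((2 / N + Real.pi) / (2 / N))))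
          = (N * M) * (2 * Real.log ((2 / N + Real.pi) / (2 / N))) := by field_simp
        rw [e]
        have h2 : (N * M) * (2 * Real.log ((2 / N + Real.pi) / (2 / N))) ≤ (N * M) * (2 * (2 * (harmonic N : ℝ))) := by
          gcongr
        linarith

lemma ae_circle {P : ℂ → Prop} (h : ∀ s : ℝ, P (Complex.exp (s * I))) : ∀ᵐ ζ ∂circleMeasure, P ζ := by
  have hm : Measurable fun θ : ℝ => Complex.exp (θ * I) := by fun_prop
  have hc : ∀ᵐ ζ ∂circleMeasure, ζ ∈ Metric.sphere (0 : ℂ) 1 := by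
    rw [circleMeasure, ae_map_iff (p := fun ζ => ζ ∈ Metric.sphere (0 : ℂ) 1) hm.aemeasurable Metric.isClosed_sphere.measurableSet]
    exact Filter.Eventually.of_forall fun θ => by simp [Complex.norm_exp_ofReal_mul_I]
  filter_upwards [hc] with ζ hζ
  have h1 : ‖ζ‖ = 1 := by simpa using hζ
  have := h ζ.arg
  have e := Complex.norm_mul_exp_arg_mul_I ζ
  rw [h1] at e
  simp only [ofReal_one, one_mul] at e
  rwa [e] at this

/-- **Theorem 2 (membership in 𝔑).** If `α` is a monotone decreasing, concave sequence of
positive numbers with `‖α‖ = ∑ α_n/(n+1) < ∞`, then for every `f ∈ H^∞` the function `f*α`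
belongs to `𝔑` and `‖f*α‖_𝔑 = ‖f*α‖_{H^∞} + Λ(f*α) ≤ 12 ‖f‖_{H^∞} ‖α‖`. -/
theorem conv_mem_frakN (α : ℕ → ℝ)
    (hpos : ∀ n, 0 < α n)
    (hdec : ∀ n, α (n + 1) ≤ α n)
    (hconc : ∀ n, 0 ≤ α n - 2 * α (n + 1) + α (n + 2))
    (hsum : Summable fun n => α n / ((n : ℝ) + 1))
    (f : ℂ → ℂ)
    (hf : DifferentiableOn ℂ f (Metric.ball (0 : ℂ) 1))
    (hfb : eSupAbs f ≠ ⊤) :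
    ∃ gs : ℂ → ℂ, IsBoundaryFn (seqConv f α) gs ∧
      DifferentiableOn ℂ (seqConv f α) (Metric.ball (0 : ℂ) 1) ∧
      eSupAbs (seqConv f α) + Lam gs ≤
        ENNReal.ofReal (12 * (eSupAbs f).toReal * ∑' n, α n / ((n : ℝ) + 1)) := by
  set M : ℝ := (eSupAbs f).toReal with hMdef
  have hM : ∀ z ∈ ball (0 : ℂ) 1, ‖f z‖ ≤ M := by
    intro z hz
    rw [hMdef, ← ENNReal.ofReal_le_iff_le_toReal hfb]
    exact le_iSup₂ (f := fun z (_ : z ∈ ball (0 : ℂ) 1) => ENNReal.ofReal ‖f z‖) z hz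
  have hM0 : 0 ≤ M := ENNReal.toReal_nonneg
  set a : ℕ → ℂ := taylorCoeff f with hadef
  have hs : ∀ z ∈ ball (0 : ℂ) 1, HasSum (fun k => a k * z ^ k) (f z) := by
    intro z hz
    refine (Complex.hasSum_taylorSeries_on_ball hf hz).congr_fun ?_
    intro k
    simp only [hadef, taylorCoeff, smul_eq_mul, sub_zero]
    ring
  set Δ : ℕ → ℝ := fun n => α n - 2 * α (n + 1) + α (n + 2) with hΔ
  have hΔ0 : ∀ n, 0 ≤ Δ n := hconc
  have h0 := seq_tendsto_zero α hpos hdec hsum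
  have hsum1 : Summable fun n : ℕ => ((n : ℝ) + 1) * Δ n := seq_summable1 α hpos hdec hconc
  have hb1 : ∑' n : ℕ, ((n : ℝ) + 1) * Δ n ≤ α 0 :=
    hsum1.tsum_le_of_sum_range_le (seq_bound1 α hpos hdec)
  set S := ∑' n, α n / ((n : ℝ) + 1) with hS
  have hα0 : α 0 ≤ S := by
    have := hsum.le_tsum 0 fun n _ => div_nonneg (hpos n).le (by positivity)
    simpa using this
  have hS0 : 0 ≤ S := (hpos 0).le.trans hα0
  set gs : ℂ → ℂ := fun z => ∑' n : ℕ, ((Δ n : ℝ) : ℂ) * TT a (n + 1) z with hgs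
  have hterm : ∀ (n : ℕ), ∀ z ∈ closedBall (0 : ℂ) 1, ‖((Δ n : ℝ) : ℂ) * TT a (n + 1) z‖ ≤ M * (((n : ℝ) + 1) * Δ n) := by
    intro n z hz
    rw [norm_mul, Complex.norm_real, Real.norm_of_nonneg (hΔ0 n)]
    have := mul_le_mul_of_nonneg_left (TT_bound_closed a f M hs hM (n + 1) z hz) (hΔ0 n)
    push_cast at this
    linarith
  have hu : Summable fun n : ℕ => M * (((n : ℝ) + 1) * Δ n) := hsum1.mul_left M
  have hsm : ∀ z ∈ closedBall (0 : ℂ) 1, Summable fun n : ℕ => ((Δ n : ℝ) : ℂ) * TT a (n + 1) z :=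
    fun z hz => Summable.of_norm_bounded hu fun n => hterm n z hz
  have heq : ∀ z ∈ ball (0 : ℂ) 1, seqConv f α z = gs z := fun z hz =>
    conv_eq α hpos hdec hconc h0 a f M hs hM z hz (hsm z (ball_subset_closedBall hz))
  have hcont : ContinuousOn gs (closedBall (0 : ℂ) 1) :=
    continuousOn_tsum (fun n => (continuous_const.mul (TT_cont a _)).continuousOn) hu hterm
  have hdiff : DifferentiableOn ℂ gs (ball (0 : ℂ) 1) :=
    differentiableOn_tsum_of_summable_norm hu
      (fun n => ((TT_diff a _).const_mul _).differentiableOn) isOpen_ball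
      (fun n z hz => hterm n z (ball_subset_closedBall hz))
  have hsup : eSupAbs (seqConv f α) ≤ ENNReal.ofReal (M * S) := by
    refine iSup₂_le fun z hz => ENNReal.ofReal_le_ofReal ?_
    rw [heq z hz]
    refine (tsum_of_norm_bounded hu.hasSum fun n => hterm n z (ball_subset_closedBall hz)).trans ?_
    rw [tsum_mul_left]
    exact mul_le_mul_of_nonneg_left (hb1.trans hα0) hM0
  have hlam : Lam gs ≤ ENNReal.ofReal (8 * M * S) := by
    refine essSup_le_of_ae_le _ (ae_circle fun s => ?_)
    have hη : Complex.exp (s * I) ∈ closedBall (0 : ℂ) 1 := by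
      simp [Complex.norm_exp_ofReal_mul_I]
    set η := Complex.exp (s * I) with hηdef
    have hle : ∀ᵐ ζ ∂circleMeasure, ENNReal.ofReal (‖gs ζ - gs η‖ / ‖ζ - η‖) ≤
        ∑' n : ℕ, ENNReal.ofReal (Δ n) * ENNReal.ofReal (‖TT a (n + 1) ζ - TT a (n + 1) η‖ / ‖ζ - η‖) := by
      refine ae_circle fun t => ?_
      have hζ : Complex.exp (t * I) ∈ closedBall (0 : ℂ) 1 := by
        simp [Complex.norm_exp_ofReal_mul_I]
      set ζ := Complex.exp (t * I)
      have hd : gs ζ - gs η = ∑' n : ℕ, ((Δ n : ℝ) : ℂ) * (TT a (n + 1) ζ - TT a (n + 1) η) := by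
        rw [hgs]; simp only
        rw [← (hsm ζ hζ).tsum_sub (hsm η hη)]
        congr 1; ext n; ring
      have hn : ∀ n : ℕ, ‖((Δ n : ℝ) : ℂ) * (TT a (n + 1) ζ - TT a (n + 1) η)‖
          = Δ n * ‖TT a (n + 1) ζ - TT a (n + 1) η‖ := fun n => by
        rw [norm_mul, Complex.norm_real, Real.norm_of_nonneg (hΔ0 n)]
      have hsn : Summable fun n : ℕ => Δ n * ‖TT a (n + 1) ζ - TT a (n + 1) η‖ := by
        have := ((hsm ζ hζ).sub (hsm η hη)).norm
        refine this.congr fun n => ?_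
        rw [← hn, mul_sub]
      have hnorm : ‖gs ζ - gs η‖ ≤ ∑' n : ℕ, Δ n * ‖TT a (n + 1) ζ - TT a (n + 1) η‖ := by
        rw [hd]
        exact tsum_of_norm_bounded hsn.hasSum fun n => (hn n).le
      calc ENNReal.ofReal (‖gs ζ - gs η‖ / ‖ζ - η‖)
          ≤ ENNReal.ofReal (∑' n : ℕ, Δ n * (‖TT a (n + 1) ζ - TT a (n + 1) η‖ / ‖ζ - η‖)) := by
            apply ENNReal.ofReal_le_ofReal
            simp_rw [← mul_div_assoc]
            rw [tsum_div_const]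
            gcongr
        _ = _ := by
            rw [ENNReal.ofReal_tsum_of_nonneg]
            · congr 1; ext n; rw [ENNReal.ofReal_mul (hΔ0 n)]
            · intro n; exact mul_nonneg (hΔ0 n) (by positivity)
            · simp_rw [← mul_div_assoc]; exact hsn.div_const _
    have hb2 : Summable fun n : ℕ => ((n : ℝ) + 1) * (harmonic (n + 1) : ℝ) * Δ n :=
      summable_of_sum_range_le (fun n => mul_nonneg (mul_nonneg (by positivity)
        (by rw [harmonic]; push_cast; positivity)) (hΔ0 n)) (seq_bound2 α hpos hdec hconc hsum)
    have hb3 : ∑' n : ℕ, ((n : ℝ) + 1) * (harmonic (n + 1) : ℝ) * Δ n ≤ 2 * S :=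
      hb2.tsum_le_of_sum_range_le (seq_bound2 α hpos hdec hconc hsum)
    calc ∫⁻ ζ, ENNReal.ofReal (‖gs ζ - gs η‖ / ‖ζ - η‖) ∂circleMeasure
        ≤ ∫⁻ ζ, ∑' n : ℕ, ENNReal.ofReal (Δ n) * ENNReal.ofReal (‖TT a (n + 1) ζ - TT a (n + 1) η‖ / ‖ζ - η‖) ∂circleMeasure :=
          lintegral_mono_ae hle
      _ = ∑' n : ℕ, ENNReal.ofReal (Δ n) * ∫⁻ ζ, ENNReal.ofReal (‖TT a (n + 1) ζ - TT a (n + 1) η‖ / ‖ζ - η‖) ∂circleMeasure := by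
          rw [lintegral_tsum]
          · congr 1; ext n
            rw [lintegral_const_mul' _ _ ENNReal.ofReal_ne_top]
          · intro n
            have := (TT_cont a (n + 1)).measurable
            fun_prop
      _ ≤ ∑' n : ℕ, ENNReal.ofReal (4 * M * (((n : ℝ) + 1) * (harmonic (n + 1) : ℝ) * Δ n)) := by
          refine ENNReal.tsum_le_tsum fun n => ?_
          refine (mul_le_mul_right (TT_lam a f M hs hM (n + 1) (by omega) s) _).trans ?_
          rw [← ENNReal.ofReal_mul (hΔ0 n)]
          apply le_of_eq; congr 1; push_cast; ring
      _ = ENNReal.ofReal (∑' n : ℕ, 4 * M * (((n : ℝ) + 1) * (harmonic (n + 1) : ℝ) * Δ n)) := by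
          rw [ENNReal.ofReal_tsum_of_nonneg _ (hb2.mul_left _)]
          intro n
          have : (0:ℝ) ≤ harmonic (n + 1) := by rw [harmonic]; push_cast; positivity
          have := hΔ0 n
          positivity
      _ ≤ _ := by
          apply ENNReal.ofReal_le_ofReal
          rw [tsum_mul_left]
          nlinarith [mul_le_mul_of_nonneg_left hb3 hM0]
  refine ⟨gs, ae_circle fun s => ?_, hdiff.congr heq, ?_⟩
  · set η := Complex.exp (s * I) with hηdef
    have hη1 : ‖η‖ = 1 := Complex.norm_exp_ofReal_mul_I s
    have hη : η ∈ closedBall (0 : ℂ) 1 := by simp [hη1]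
    have hin : ∀ᶠ r : ℝ in nhdsWithin 1 (Set.Iio 1), (r : ℂ) * η ∈ ball (0 : ℂ) 1 := by
      have : Set.Ioo (0:ℝ) 1 ∈ nhdsWithin (1:ℝ) (Set.Iio 1) := Ioo_mem_nhdsLT zero_lt_one
      filter_upwards [this] with r hr
      simp only [mem_ball_zero_iff, norm_mul, hη1, mul_one, Complex.norm_real, Real.norm_of_nonneg hr.1.le]
      exact hr.2
    have ht : Filter.Tendsto (fun r : ℝ => (r : ℂ) * η) (nhdsWithin 1 (Set.Iio 1)) (nhdsWithin η (closedBall 0 1)) := by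
      refine tendsto_nhdsWithin_iff.2 ⟨?_, hin.mono fun r hr => ball_subset_closedBall hr⟩
      have hc : Continuous fun r : ℝ => (r : ℂ) * η := by fun_prop
      have := hc.tendsto 1
      simp only [ofReal_one, one_mul] at this
      exact this.mono_left nhdsWithin_le_nhds
    exact ((hcont η hη).tendsto.comp ht).congr' (hin.mono fun r hr => (heq _ hr).symm)
  · refine (add_le_add hsup hlam).trans ?_
    rw [← ENNReal.ofReal_add (by positivity) (by positivity)]
    apply ENNReal.ofReal_le_ofReal
    nlinarith [mul_nonneg hM0 hS0]
end
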